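/- Let k ≥ 2 and suppose E[ξ^{k+1}] < ∞. Then there exists C₁ > 0 such that for all n ∈ I and all t ≥ 1: the probability under τ_n that max over nodes v on the heavy path V(1*) of N_k(v) is at least t is at most C₁·√n·t^{−(k−1)/2}. If E[ξ^{(3k+1)/2}] < ∞, the same holds with N_k(v) replaced by N_{k+}(v), upon possibly increasing C₁. Finally, if E[ξ^{k+2}] < ∞, there exists C₂ > 0 such that the probability under τ_n that max over nodes v on the heavy path and ranks ℓ ≥ k of H*(v,ℓ) is at least t is at most C₂·√n·t^{−(k−1)}. -/

import Mathlib

/-! Finite ordered rooted (plane) trees: a tree is a finite list of its root subtrees. -/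
inductive PTree : Type where
  | node : List PTree → PTree

namespace PTree

/-- the number of nodes of the tree -/
def size : PTree → ℕ
  | node ts => 1 + (ts.attach.map (fun x => size x.1)).sum
decreasing_by
  have := List.sizeOf_lt_of_mem x.2
  simp only [node.sizeOf_spec]; omega

/-- the list of all subtrees rooted at the nodes of the tree -/
def subtrees : PTree → List PTree
  | node ts => node ts :: (ts.attach.map (fun x => subtrees x.1)).flatten
decreasing_by
  have := List.sizeOf_lt_of_mem x.2
  simp only [node.sizeOf_spec]; omega

/-- the height of the tree (maximal distance from the root to a node) -/
def height : PTree → ℕ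
  | node ts => (ts.attach.map (fun x => height x.1 + 1)).foldr max 0
decreasing_by
  have := List.sizeOf_lt_of_mem x.2
  simp only [node.sizeOf_spec]; omega

/-- the number of children of the root (`ξ_ε`) -/
def rootDeg : PTree → ℕ
  | node ts => ts.length

/-- the sizes of the subtrees rooted at the children of the root -/
def childSizes : PTree → List ℕ
  | node ts => ts.map size

/-- the sizes of the subtrees rooted at the children of the root,
sorted from largest to smallest -/
def sortedSizesDesc (T : PTree) : List ℕ :=
  T.childSizes.insertionSort (· ≥ ·)

/-- `N_k`: the `k`-th largest among the sizes of the subtrees rooted at the children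
of the root (`0` if there are fewer than `k` children) -/
def Nk (k : ℕ) (T : PTree) : ℕ := (sortedSizesDesc T).getD (k - 1) 0

/-- `N_{k+} = N_k + N_{k+1} + ⋯` -/
def NkPlus (k : ℕ) (T : PTree) : ℕ := ((sortedSizesDesc T).drop (k - 1)).sum

/-- the subtrees rooted at the nodes of the heavy path: starting at the root, always
continue to the first child of maximal subtree size -/
def heavyPath : PTree → List PTree
  | node ts =>
    node ts ::
      (match ts.attach.find? (fun x => x.1.size = ((ts.map size).foldr max 0)) with
       | some x => heavyPath x.1
       | none => [])
decreasing_by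
  have := List.sizeOf_lt_of_mem x.2
  simp only [node.sizeOf_spec]; omega

end PTree

/-- `Z_k`: the number of nodes `v` of the tree whose subtree has size `k` -/
def Zk (k : ℕ) (T : PTree) : ℕ := (T.subtrees.filter (fun s => s.size = k)).length

/-- the rank (`1` = largest) of the `i`-th child (0-based) among siblings whose subtree
sizes are given by the list `sizes`; ties are broken from left to right -/
def rankIn (sizes : List ℕ) (i : ℕ) : ℕ :=
  1 + ((List.range sizes.length).filter (fun j =>
        sizes.getD i 0 < sizes.getD j 0 ∨ (sizes.getD j 0 = sizes.getD i 0 ∧ j < i))).length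

mutual
/-- the number of nodes of the `k`-heavy tree: the root together with all nodes `v` such
that `v` and every non-root ancestor of `v` has rank at most `k` among its siblings -/
def heavySize (k : ℕ) : PTree → ℕ
  | .node ts => 1 + heavySizeAux k (ts.map PTree.size) 0 ts
def heavySizeAux (k : ℕ) (sizes : List ℕ) : ℕ → List PTree → ℕ
  | _, [] => 0
  | i, t :: rest =>
      (if rankIn sizes i ≤ k then heavySize k t else 0) + heavySizeAux k sizes (i + 1) rest
end

/-- `H*(v,ℓ)`: the height of the subtree rooted at the child of rank `ℓ` of the root of `v`
(`0` if there are fewer than `ℓ` children) -/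
def Hstar : PTree → ℕ → ℕ
  | .node ts, ℓ =>
    match (List.range ts.length).find? (fun i => rankIn (ts.map PTree.size) i = ℓ) with
    | some i => (ts.getD i (.node [])).height
    | none => 0

/-- the weight of a tree: the product over all nodes `v` of `p (number of children of v)` -/
noncomputable def weight (p : ℕ → ℝ) : PTree → ℝ
  | .node ts => p ts.length * (ts.attach.map (fun x => weight p x.1)).prod
decreasing_by
  have := List.sizeOf_lt_of_mem x.2
  simp only [PTree.node.sizeOf_spec]; omega

/-- the total weight of all trees of size `n` -/
noncomputable def treeSum (p : ℕ → ℝ) (n : ℕ) : ℝ :=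
  ∑' T : {T : PTree // T.size = n}, weight p T.1

/-- the probability of the event `A` under the conditional Galton-Watson tree `τ_n` -/
noncomputable def condProb (p : ℕ → ℝ) (n : ℕ) (A : PTree → Prop) : ℝ :=
  (∑' T : {T : PTree // T.size = n ∧ A T}, weight p T.1) / treeSum p n

/-- the expectation of `f` under the conditional Galton-Watson tree `τ_n` -/
noncomputable def condExp (p : ℕ → ℝ) (n : ℕ) (f : PTree → ℝ) : ℝ :=
  (∑' T : {T : PTree // T.size = n}, weight p T.1 * f T.1) / treeSum p n

/-- the variance of `f` under the conditional Galton-Watson tree `τ_n` -/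
noncomputable def condVar (p : ℕ → ℝ) (n : ℕ) (f : PTree → ℝ) : ℝ :=
  condExp p n (fun T => f T ^ 2) - (condExp p n f) ^ 2

/-- the set `I = {n ≥ 1 : Σ_{|T| = n} w(T) > 0}` of sizes of positive probability -/
def gwSupport (p : ℕ → ℝ) : Set ℕ := {n | 1 ≤ n ∧ 0 < treeSum p n}

/-- `P(S_m = x)` for the random walk `S_m = (ξ_1 - 1) + ⋯ + (ξ_m - 1)`, `ξ_i` i.i.d. `∼ p` -/
noncomputable def walkProb (p : ℕ → ℝ) (m : ℕ) (x : ℤ) : ℝ :=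
  ∑' a : Fin m → ℕ, if (∑ i, ((a i : ℤ) - 1)) = x then ∏ i, p (a i) else 0

/-- `I_n = {1 ≤ k ≤ n : P(S_{n-k} = 0) > 0}` -/
def walkSupportIn (p : ℕ → ℝ) (n : ℕ) : Set ℕ :=
  {k | 1 ≤ k ∧ k ≤ n ∧ 0 < walkProb p (n - k) 0}

/-- `h = gcd {i > 0 : p_i > 0}`, defined as the largest common divisor of the support -/
noncomputable def gcdSupp (p : ℕ → ℝ) : ℕ :=
  sSup {d : ℕ | 0 < d ∧ ∀ i : ℕ, 0 < i → 0 < p i → d ∣ i}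

/-- `α = h / (σ √(2π))` where `σ² = Σ i² p_i - 1` -/
noncomputable def gwAlpha (p : ℕ → ℝ) : ℝ :=
  (gcdSupp p : ℝ) /
    (Real.sqrt ((∑' i : ℕ, (i : ℝ) ^ 2 * p i) - 1) * Real.sqrt (2 * Real.pi))

/-- the moment `E[ξ^m] = Σ i^m p_i` is finite -/
def MomentFinite (p : ℕ → ℝ) (m : ℝ) : Prop :=
  Summable (fun i : ℕ => (i : ℝ) ^ m * p i)

section

open Filter Topology MeasureTheory

/-- A critical offspring distribution with finite positive variance. -/
structure IsCritical (p : ℕ → ℝ) : Prop where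
  nonneg : ∀ i, 0 ≤ p i
  sum : HasSum p 1
  mean : HasSum (fun i : ℕ => (i : ℝ) * p i) 1
  sq : Summable (fun i : ℕ => (i : ℝ) ^ 2 * p i)
  var : 1 < ∑' i : ℕ, (i : ℝ) ^ 2 * p i

namespace IsCritical

variable {p : ℕ → ℝ}

lemma exists_two_le_pos (hp : IsCritical p) : ∃ d, 2 ≤ d ∧ 0 < p d := by
  by_contra! h
  have h0 : ∀ d, 2 ≤ d → p d = 0 := fun d hd => le_antisymm (h d hd) (hp.nonneg d)
  have : (fun i : ℕ => (i : ℝ) ^ 2 * p i) = fun i : ℕ => (i : ℝ) * p i := by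
    funext i
    rcases lt_or_ge i 2 with hi | hi
    · interval_cases i <;> simp
    · simp [h0 i hi]
  have h1 := hp.var
  rw [this, hp.mean.tsum_eq] at h1
  exact lt_irrefl _ h1

lemma zero_pos (hp : IsCritical p) : 0 < p 0 := by
  refine (hp.nonneg 0).lt_of_ne' fun h => ?_
  obtain ⟨d, hd, hpd⟩ := hp.exists_two_le_pos
  have h1 : HasSum (fun i : ℕ => (i : ℝ) * p i - p i) 0 := by
    simpa using hp.mean.sub hp.sum
  have h2 : ∀ i : ℕ, 0 ≤ (i : ℝ) * p i - p i := by
    intro i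
    rcases Nat.eq_zero_or_pos i with rfl | hi
    · simp [h]
    · have : (1 : ℝ) ≤ i := by exact_mod_cast hi
      nlinarith [hp.nonneg i]
  have h3 := (hasSum_zero_iff_of_nonneg h2).1 h1
  have h4 := congrFun h3 d
  have : (2 : ℝ) ≤ d := by exact_mod_cast hd
  simp only [Pi.zero_apply] at h4
  nlinarith

/-- The characteristic function of an offspring distribution. -/
noncomputable def cf (p : ℕ → ℝ) (θ : ℝ) : ℂ := ∑' j : ℕ, (p j : ℂ) * Complex.exp (Complex.I * (θ * j : ℝ))

lemma norm_term (hp : IsCritical p) (θ : ℝ) (j : ℕ) :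
    ‖(p j : ℂ) * Complex.exp (Complex.I * (θ * j : ℝ))‖ = p j := by
  rw [norm_mul, Complex.norm_exp_I_mul_ofReal, mul_one, Complex.norm_real, Real.norm_of_nonneg (hp.nonneg j)]

lemma summable_cf (hp : IsCritical p) (θ : ℝ) :
    Summable fun j : ℕ => ‖(p j : ℂ) * Complex.exp (Complex.I * (θ * j : ℝ))‖ := by
  simp_rw [hp.norm_term]
  exact hp.sum.summable

/-- Coefficients of the powers of the offspring generating function. -/
noncomputable def cpow (p : ℕ → ℝ) (n j : ℕ) : ℝ := PowerSeries.coeff j (PowerSeries.mk p ^ n)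

lemma cpow_zero (j : ℕ) : cpow p 0 j = if j = 0 then 1 else 0 := by
  simp [cpow, PowerSeries.coeff_one]

lemma cpow_succ (n j : ℕ) :
    cpow p (n + 1) j = ∑ x ∈ Finset.HasAntidiagonal.antidiagonal j, cpow p n x.1 * p x.2 := by
  simp [cpow, pow_succ, PowerSeries.coeff_mul]

lemma cpow_nonneg (hp : IsCritical p) (n j : ℕ) : 0 ≤ cpow p n j := by
  induction n generalizing j with
  | zero => rw [cpow_zero]; split_ifs <;> norm_num
  | succ n ih =>
    rw [cpow_succ]
    exact Finset.sum_nonneg fun x _ => mul_nonneg (ih _) (hp.nonneg _)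

lemma cf_pow (hp : IsCritical p) (n : ℕ) (θ : ℝ) :
    (Summable fun j : ℕ => ‖(cpow p n j : ℂ) * Complex.exp (Complex.I * (θ * j : ℝ))‖) ∧
    ∑' j : ℕ, (cpow p n j : ℂ) * Complex.exp (Complex.I * (θ * j : ℝ)) = cf p θ ^ n := by
  induction n with
  | zero =>
    have : ∀ j : ℕ, j ≠ 0 → (cpow p 0 j : ℂ) * Complex.exp (Complex.I * (θ * j : ℝ)) = 0 := by
      intro j hj; simp [cpow_zero, hj]
    constructor
    · refine summable_of_ne_finset_zero (s := {0}) fun j hj => ?_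
      rw [this j (by simpa using hj), norm_zero]
    · rw [tsum_eq_single 0 this]; simp [cpow_zero]
  | succ n ih =>
    have key : ∀ j : ℕ, (cpow p (n + 1) j : ℂ) * Complex.exp (Complex.I * (θ * j : ℝ)) =
        ∑ x ∈ Finset.HasAntidiagonal.antidiagonal j, ((cpow p n x.1 : ℂ) * Complex.exp (Complex.I * (θ * x.1 : ℝ))) *
          ((p x.2 : ℂ) * Complex.exp (Complex.I * (θ * x.2 : ℝ))) := by
      intro j
      rw [cpow_succ, Complex.ofReal_sum]
      rw [Finset.sum_mul]
      refine Finset.sum_congr rfl fun x hx => ?_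
      rw [← Finset.HasAntidiagonal.mem_antidiagonal.1 hx, Complex.ofReal_mul]
      rw [show Complex.I * ((θ * (x.1 + x.2 : ℕ) : ℝ) : ℂ) =
          Complex.I * ((θ * x.1 : ℝ) : ℂ) + Complex.I * ((θ * x.2 : ℝ) : ℂ) by
        push_cast; ring, Complex.exp_add]
      ring
    have h1 := summable_norm_sum_mul_antidiagonal_of_summable_norm ih.1 (hp.summable_cf θ)
    have h2 := tsum_mul_tsum_eq_tsum_sum_antidiagonal_of_summable_norm ih.1 (hp.summable_cf θ)
    refine ⟨h1.congr fun j => by rw [← key], ?_⟩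
    rw [ih.2] at h2
    rw [pow_succ, tsum_congr key, ← h2, cf]

lemma summable_cpow (hp : IsCritical p) (n : ℕ) : Summable (cpow p n) := by
  have := (hp.cf_pow n 0).1
  refine this.congr fun j => ?_
  simp [abs_of_nonneg (hp.cpow_nonneg n j)]

lemma dvd_of_cpow_ne_zero {h : ℕ} (hh : ∀ i, p i ≠ 0 → h ∣ i) (n j : ℕ) (hj : cpow p n j ≠ 0) :
    h ∣ j := by
  induction n generalizing j with
  | zero =>
    rw [cpow_zero] at hj
    have : j = 0 := by by_contra hne; simp [hne] at hj
    simp [this]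
  | succ n ih =>
    rw [cpow_succ] at hj
    obtain ⟨x, hx, hne⟩ := Finset.exists_ne_zero_of_sum_ne_zero hj
    rw [← Finset.HasAntidiagonal.mem_antidiagonal.1 hx]
    exact dvd_add (ih _ (left_ne_zero_of_mul hne)) (hh _ (right_ne_zero_of_mul hne))

lemma continuous_cf (hp : IsCritical p) : Continuous (cf p) := by
  unfold cf
  refine continuous_tsum (u := p) (fun j => by fun_prop) hp.sum.summable fun j θ => ?_
  rw [hp.norm_term]

/-- Fourier inversion over one period of the lattice. -/
lemma integral_cf_pow (hp : IsCritical p) {h : ℕ} (hpos : 0 < h) (hh : ∀ i, p i ≠ 0 → h ∣ i)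
    (n j : ℕ) (hj : h ∣ j) :
    ∫ θ in (-(Real.pi / h))..(Real.pi / h), cf p θ ^ n * Complex.exp (-(Complex.I * (θ * j : ℝ))) =
      (2 * Real.pi / h : ℝ) * (cpow p n j : ℂ) := by
  have hh0 : (h : ℝ) ≠ 0 := by positivity
  have H := intervalIntegral.hasSum_integral_of_dominated_convergence (μ := volume)
    (a := -(Real.pi / h)) (b := Real.pi / h)
    (F := fun (l : ℕ) (θ : ℝ) => (cpow p n l : ℂ) * Complex.exp (Complex.I * (θ * l : ℝ)) *
      Complex.exp (-(Complex.I * (θ * j : ℝ))))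
    (f := fun θ => cf p θ ^ n * Complex.exp (-(Complex.I * (θ * j : ℝ))))
    (fun l _ => cpow p n l) (fun l => by
      apply Continuous.aestronglyMeasurable; fun_prop)
    (fun l => Eventually.of_forall fun θ _ => by
      rw [norm_mul, norm_mul, Complex.norm_exp_I_mul_ofReal, ← mul_neg, ← Complex.ofReal_neg,
        Complex.norm_exp_I_mul_ofReal, mul_one, mul_one, Complex.norm_real,
        Real.norm_of_nonneg (hp.cpow_nonneg n l)])
    (Eventually.of_forall fun θ _ => hp.summable_cpow n)
    (by simp)
    (Eventually.of_forall fun θ _ => by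
      have := (hp.cf_pow n θ)
      rw [← this.2]
      exact this.1.of_norm.hasSum.mul_right _)
  have H2 : ∀ l : ℕ, l ≠ j → ∫ θ in (-(Real.pi / h))..(Real.pi / h),
      ((cpow p n l : ℂ) * Complex.exp (Complex.I * (θ * l : ℝ)) *
        Complex.exp (-(Complex.I * (θ * j : ℝ)))) = 0 := by
    intro l hl
    by_cases h0 : cpow p n l = 0
    · simp [h0]
    obtain ⟨a, ha⟩ := dvd_of_cpow_ne_zero hh n l h0
    obtain ⟨b, hb⟩ := hj
    have hab : (a : ℂ) - b ≠ 0 := by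
      rw [sub_ne_zero]
      intro hab
      have : a = b := by exact_mod_cast hab
      exact hl (by rw [ha, hb, this])
    have hc : Complex.I * (h * (a - b) : ℂ) ≠ 0 := by
      refine mul_ne_zero Complex.I_ne_zero (mul_ne_zero (by exact_mod_cast hpos.ne') hab)
    have e1 : ∀ θ : ℝ, (cpow p n l : ℂ) * Complex.exp (Complex.I * (θ * l : ℝ)) *
        Complex.exp (-(Complex.I * (θ * j : ℝ))) =
        (cpow p n l : ℂ) * Complex.exp (Complex.I * (h * (a - b) : ℂ) * θ) := by
      intro θ
      rw [mul_assoc, ← Complex.exp_add, ha, hb]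
      congr 2
      push_cast
      ring
    simp_rw [e1]
    rw [intervalIntegral.integral_const_mul, integral_exp_mul_complex hc]
    have hhc : (h : ℂ) ≠ 0 := by exact_mod_cast hpos.ne'
    have e2 : Complex.exp (Complex.I * (h * (a - b) : ℂ) * (Real.pi / h : ℝ)) =
        Complex.exp (Complex.I * (h * (a - b) : ℂ) * (-(Real.pi / h) : ℝ)) := by
      rw [Complex.exp_eq_exp_iff_exists_int]
      refine ⟨(a : ℤ) - b, ?_⟩
      push_cast
      field_simp
      ring
    rw [e2]; simp
  have H3 := H.unique (hasSum_single j H2)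
  rw [H3]
  have e3 : ∀ θ : ℝ, (cpow p n j : ℂ) * Complex.exp (Complex.I * (θ * j : ℝ)) *
        Complex.exp (-(Complex.I * (θ * j : ℝ))) = cpow p n j := by
    intro θ
    rw [mul_assoc, ← Complex.exp_add]; simp
  simp_rw [e3]
  rw [intervalIntegral.integral_const]
  simp only [Complex.real_smul]
  congr 2
  ring

end IsCritical

end

section

open Filter Topology MeasureTheory
namespace IsCritical

variable {p : ℕ → ℝ}

lemma norm_two_atoms_le {x y : ℝ} (hx : 0 < x) (hy : 0 < y) (α : ℝ) :
    ‖(x : ℂ) + y * Complex.exp (Complex.I * (α : ℝ))‖ ≤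
      x + y - 2 * x * y / (x + y) * Real.sin (α / 2) ^ 2 := by
  have hxy : 0 < x + y := by positivity
  set s := Real.sin (α / 2) with hs
  have hs1 : s ^ 2 ≤ 1 := Real.sin_sq_le_one _
  have hcos : Real.cos α = 1 - 2 * s ^ 2 := by
    have := Real.cos_two_mul (α / 2)
    have h2 := Real.sin_sq_add_cos_sq (α / 2)
    rw [show 2 * (α / 2) = α by ring] at this
    rw [this]; linarith
  have hsin : Real.sin α ^ 2 = 1 - Real.cos α ^ 2 := by
    have := Real.sin_sq_add_cos_sq α; linarith
  have e : (x : ℂ) + y * Complex.exp (Complex.I * (α : ℝ)) =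
      ((x + y * Real.cos α : ℝ) : ℂ) + ((y * Real.sin α : ℝ) : ℂ) * Complex.I := by
    rw [mul_comm Complex.I, Complex.exp_mul_I]
    push_cast; ring
  have hnn : 0 ≤ x + y - 2 * x * y / (x + y) * s ^ 2 := by
    have : 2 * x * y / (x + y) ≤ x + y := by
      rw [div_le_iff₀ hxy]; nlinarith [sq_nonneg x, sq_nonneg y]
    have h0 : 0 ≤ 2 * x * y / (x + y) := by positivity
    nlinarith
  rw [e, Complex.norm_add_mul_I]
  refine Real.sqrt_le_iff.2 ⟨hnn, ?_⟩
  have : (2 * x * y / (x + y)) * (x + y) = 2 * x * y := by field_simp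
  set K := 2 * x * y / (x + y)
  have e1 : (x + y * Real.cos α) ^ 2 + (y * Real.sin α) ^ 2 = (x + y) ^ 2 - 2 * (2 * x * y) * s ^ 2 := by
    rw [mul_pow, hsin, hcos]; ring
  rw [e1, ← this]
  nlinarith [sq_nonneg (K * s ^ 2)]

lemma norm_cf_le_one (hp : IsCritical p) (θ : ℝ) : ‖cf p θ‖ ≤ 1 := by
  refine (norm_tsum_le_tsum_norm (hp.summable_cf θ)).trans ?_
  simp_rw [hp.norm_term]
  exact hp.sum.tsum_eq.le

lemma sin_sq_le_one_sub_norm_cf (hp : IsCritical p) {a : ℕ} (ha : 0 < p a) (ha0 : a ≠ 0) (θ : ℝ) :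
    2 * p 0 * p a / (p 0 + p a) * Real.sin (a * θ / 2) ^ 2 ≤ 1 - ‖cf p θ‖ := by
  have h1 := (hp.summable_cf θ).of_norm.sum_add_tsum_compl (s := {0, a})
  have h2 := hp.sum.summable.sum_add_tsum_compl (s := {0, a})
  rw [Finset.sum_pair ha0.symm] at h1 h2
  have h3 : ‖∑' x : ↑((↑({0, a} : Finset ℕ) : Set ℕ)ᶜ), (p x : ℂ) * Complex.exp (Complex.I * (θ * (x : ℕ) : ℝ))‖ ≤
      ∑' x : ↑((↑({0, a} : Finset ℕ) : Set ℕ)ᶜ), p x := by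
    have := norm_tsum_le_tsum_norm ((hp.summable_cf θ).subtype ((↑({0, a} : Finset ℕ) : Set ℕ)ᶜ))
    refine this.trans (le_of_eq (tsum_congr fun x => ?_))
    exact hp.norm_term θ x
  have h4 := norm_two_atoms_le hp.zero_pos ha (θ * a)
  have h5 : ‖cf p θ‖ ≤ ‖(p 0 : ℂ) + p a * Complex.exp (Complex.I * (θ * a : ℝ))‖ +
      ∑' x : ↑((↑({0, a} : Finset ℕ) : Set ℕ)ᶜ), p x := by
    refine le_trans ?_ (add_le_add_right h3 _)
    rw [cf, ← h1]
    refine (norm_add_le _ _).trans (le_of_eq ?_)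
    simp
  rw [hp.sum.tsum_eq] at h2
  rw [show (a : ℝ) * θ / 2 = θ * a / 2 by ring]
  linarith

lemma exists_lattice (hp : IsCritical p) : ∃ h : ℕ, 0 < h ∧ (∀ i, p i ≠ 0 → h ∣ i) ∧
    ∃ c : ℝ, 0 < c ∧ ∀ θ, c * Real.sin (h * θ / 2) ^ 2 ≤ 1 - ‖cf p θ‖ := by
  let S : AddSubgroup ℤ :=
    { carrier := {m | ∃ c : ℝ, 0 < c ∧ ∀ θ, c * Real.sin (m * θ / 2) ^ 2 ≤ 1 - ‖cf p θ‖}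
      zero_mem' := ⟨1, one_pos, fun θ => by simpa using hp.norm_cf_le_one θ⟩
      add_mem' := by
        rintro a b ⟨c, hc, h1⟩ ⟨d, hd, h2⟩
        refine ⟨min c d / 4, by positivity, fun θ => ?_⟩
        have e : (((a + b : ℤ) : ℝ) * θ / 2) = a * θ / 2 + b * θ / 2 := by push_cast; ring
        rw [e, Real.sin_add]
        set x := Real.sin (a * θ / 2)
        set y := Real.sin (b * θ / 2)
        set u := Real.cos (a * θ / 2)
        set v := Real.cos (b * θ / 2)
        have hu : u ^ 2 ≤ 1 := Real.cos_sq_le_one _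
        have hv : v ^ 2 ≤ 1 := Real.cos_sq_le_one _
        have h3 : (x * v + u * y) ^ 2 ≤ 2 * (x ^ 2 + y ^ 2) := by
          nlinarith [sq_nonneg (x * v - u * y), mul_nonneg (sq_nonneg x) (sub_nonneg.2 hv),
            mul_nonneg (sq_nonneg y) (sub_nonneg.2 hu)]
        have h4 : min c d * x ^ 2 ≤ 1 - ‖cf p θ‖ :=
          (mul_le_mul_of_nonneg_right (min_le_left c d) (sq_nonneg x)).trans (h1 θ)
        have h5 : min c d * y ^ 2 ≤ 1 - ‖cf p θ‖ :=
          (mul_le_mul_of_nonneg_right (min_le_right c d) (sq_nonneg y)).trans (h2 θ)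
        have h6 : 0 < min c d := lt_min hc hd
        nlinarith
      neg_mem' := by
        rintro a ⟨c, hc, h1⟩
        refine ⟨c, hc, fun θ => ?_⟩
        have e : (((-a : ℤ) : ℝ) * θ / 2) = -(a * θ / 2) := by push_cast; ring
        rw [e, Real.sin_neg, neg_sq]
        exact h1 θ }
  obtain ⟨g, hg⟩ := Int.subgroup_cyclic S
  rw [← AddSubgroup.zmultiples_eq_closure] at hg
  have hmem : ∀ i : ℕ, p i ≠ 0 → g ∣ (i : ℤ) := by
    intro i hi
    rw [← Int.mem_zmultiples_iff, ← hg]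
    by_cases hi0 : i = 0
    · subst hi0; exact S.zero_mem
    have hpi := (hp.nonneg i).lt_of_ne' hi
    have := hp.zero_pos
    exact ⟨2 * p 0 * p i / (p 0 + p i), by positivity, fun θ => hp.sin_sq_le_one_sub_norm_cf hpi hi0 θ⟩
  refine ⟨g.natAbs, ?_, fun i hi => Int.natCast_dvd_natCast.1 (by simpa using hmem i hi), ?_⟩
  · obtain ⟨d, hd, hpd⟩ := hp.exists_two_le_pos
    rw [Int.natAbs_pos]
    rintro rfl
    have := hmem d hpd.ne'
    simp at this
    omega
  · have : (g.natAbs : ℤ) ∈ S := by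
      rw [hg, Int.mem_zmultiples_iff]; simp
    obtain ⟨c, hc, h⟩ := this
    exact ⟨c, hc, fun θ => by simpa using h θ⟩

/-- Gaussian domination of the characteristic function over one period. -/
lemma exists_norm_cf_pow_le (hp : IsCritical p) : ∃ h : ℕ, 0 < h ∧ (∀ i, p i ≠ 0 → h ∣ i) ∧
    ∃ c : ℝ, 0 < c ∧ ∀ θ : ℝ, |θ| ≤ Real.pi / h → ∀ n : ℕ,
      ‖cf p θ‖ ^ n ≤ Real.exp (-(c * n) * θ ^ 2) := by
  obtain ⟨h, hpos, hh, c, hc, H⟩ := hp.exists_lattice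
  have hpos' : (0 : ℝ) < h := by exact_mod_cast hpos
  refine ⟨h, hpos, hh, c * (h / Real.pi) ^ 2, by positivity, fun θ hθ n => ?_⟩
  have h1 : (h / Real.pi * |θ|) ≤ |Real.sin (h * θ / 2)| := by
    have := Real.mul_abs_le_abs_sin (x := h * θ / 2) (by
      rw [abs_div, abs_mul, abs_of_pos hpos', abs_two]
      rw [le_div_iff₀ hpos'] at hθ
      linarith)
    refine le_trans (le_of_eq ?_) this
    rw [abs_div, abs_mul, abs_of_pos hpos', abs_two]
    ring
  have h2 : (h / Real.pi) ^ 2 * θ ^ 2 ≤ Real.sin (h * θ / 2) ^ 2 := by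
    rw [← sq_abs θ, ← mul_pow, ← sq_abs (Real.sin _)]
    exact pow_le_pow_left₀ (by positivity) h1 2
  have h3 : ‖cf p θ‖ ≤ Real.exp (-(c * (h / Real.pi) ^ 2 * θ ^ 2)) := by
    have := Real.add_one_le_exp (-(c * (h / Real.pi) ^ 2 * θ ^ 2))
    have h4 := H θ
    nlinarith
  calc ‖cf p θ‖ ^ n ≤ Real.exp (-(c * (h / Real.pi) ^ 2 * θ ^ 2)) ^ n :=
        pow_le_pow_left₀ (norm_nonneg _) h3 n
    _ = _ := by rw [← Real.exp_nat_mul]; congr 1; ring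

end IsCritical

end

section

open Filter Topology MeasureTheory
namespace IsCritical

variable {p : ℕ → ℝ}

/-- Uniform upper bound in the local limit theorem. -/
lemma exists_cpow_le (hp : IsCritical p) : ∃ C : ℝ, 0 < C ∧ ∀ n : ℕ, 1 ≤ n → ∀ j,
    cpow p n j ≤ C / Real.sqrt n := by
  obtain ⟨h, hpos, hh, c, hc, H⟩ := hp.exists_norm_cf_pow_le
  have hpos' : (0 : ℝ) < h := by exact_mod_cast hpos
  have hpi := Real.pi_pos
  refine ⟨h / (2 * Real.pi) * Real.sqrt (Real.pi / c), by positivity, fun n hn j => ?_⟩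
  have hn' : (0 : ℝ) < n := by exact_mod_cast hn
  by_cases hj : h ∣ j
  swap
  · have : cpow p n j = 0 := by
      by_contra h0; exact hj (dvd_of_cpow_ne_zero hh n j h0)
    rw [this]; positivity
  have h1 := hp.integral_cf_pow hpos hh n j hj
  have h2 : ‖∫ θ in (-(Real.pi / h))..(Real.pi / h), cf p θ ^ n * Complex.exp (-(Complex.I * (θ * j : ℝ)))‖
      ≤ ∫ θ in (-(Real.pi / h))..(Real.pi / h), Real.exp (-(c * n) * θ ^ 2) := by
    refine intervalIntegral.norm_integral_le_of_norm_le (by have : 0 ≤ Real.pi / h := by positivity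
                                                            linarith) ?_ ?_
    · refine Eventually.of_forall fun θ hθ => ?_
      rw [norm_mul, norm_pow, ← mul_neg, ← Complex.ofReal_neg, Complex.norm_exp_I_mul_ofReal, mul_one]
      exact H θ (abs_le.2 ⟨hθ.1.le, hθ.2⟩) n
    · apply Continuous.intervalIntegrable; fun_prop
  have h3 : ∫ θ in (-(Real.pi / h))..(Real.pi / h), Real.exp (-(c * n) * θ ^ 2) ≤
      Real.sqrt (Real.pi / (c * n)) := by
    rw [← integral_gaussian, intervalIntegral.integral_of_le
      (by have : 0 ≤ Real.pi / h := by positivity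
          linarith)]
    exact setIntegral_le_integral (integrable_exp_neg_mul_sq (by positivity))
      (Eventually.of_forall fun θ => (Real.exp_pos _).le)
  rw [h1, norm_mul, Complex.norm_real, Complex.norm_real,
    Real.norm_of_nonneg (hp.cpow_nonneg n j), Real.norm_of_nonneg (by positivity)] at h2
  have h4 := h2.trans h3
  rw [← div_div, Real.sqrt_div' _ hn'.le] at h4
  calc cpow p n j = h / (2 * Real.pi) * (2 * Real.pi / h * cpow p n j) := by field_simp
    _ ≤ h / (2 * Real.pi) * (Real.sqrt (Real.pi / c) / Real.sqrt n) := by gcongr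
    _ = _ := by ring

lemma norm_exp_I_sub_le (x : ℝ) :
    ‖Complex.exp (Complex.I * (x : ℝ)) - 1 - Complex.I * (x : ℝ)‖ ≤ 3 * x ^ 2 := by
  have hI : ‖Complex.I * (x : ℂ)‖ = |x| := by simp
  rcases le_or_gt |x| 1 with h | h
  · have := Complex.norm_exp_sub_one_sub_id_le (x := Complex.I * x) (by rw [hI]; exact h)
    rw [hI, sq_abs] at this
    nlinarith [sq_nonneg x]
  · calc _ ≤ ‖Complex.exp (Complex.I * (x : ℝ))‖ + ‖(1 : ℂ)‖ + ‖Complex.I * (x : ℝ)‖ :=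
        (norm_sub_le _ _).trans (add_le_add_left (norm_sub_le _ _) _)
      _ = 2 + |x| := by rw [hI, Complex.norm_exp_I_mul_ofReal, norm_one]; ring
      _ ≤ 3 * x ^ 2 := by rw [← sq_abs x]; nlinarith

lemma tendsto_mul_exp_I_sub (y : ℝ) :
    Tendsto (fun n : ℕ => (n : ℂ) * (Complex.exp (Complex.I * (y / Real.sqrt n : ℝ)) - 1 -
      Complex.I * (y / Real.sqrt n : ℝ))) atTop (𝓝 (-(y ^ 2 / 2) : ℝ)) := by
  rw [tendsto_iff_norm_sub_tendsto_zero]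
  have hlim : Tendsto (fun n : ℕ => |y| / Real.sqrt n) atTop (𝓝 0) :=
    tendsto_const_nhds.div_atTop (Real.tendsto_sqrt_atTop.comp tendsto_natCast_atTop_atTop)
  have hlim2 : Tendsto (fun n : ℕ => y ^ 2 * (|y| / Real.sqrt n)) atTop (𝓝 0) := by
    simpa using hlim.const_mul (y ^ 2)
  refine squeeze_zero' (Eventually.of_forall fun n => norm_nonneg _) ?_ hlim2
  filter_upwards [hlim.eventually (gt_mem_nhds one_pos), eventually_gt_atTop 0] with n hn hn0
  have hn' : (0 : ℝ) < n := by exact_mod_cast hn0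
  set x : ℝ := y / Real.sqrt n with hx
  have hxa : |x| = |y| / Real.sqrt n := by rw [hx, abs_div, abs_of_nonneg (Real.sqrt_nonneg _)]
  have hI : ‖Complex.I * (x : ℂ)‖ = |x| := by simp
  have hb := Complex.exp_bound (x := Complex.I * x) (by rw [hI, hxa]; exact hn.le) (n := 3) (by norm_num)
  rw [hI] at hb
  have hsq : (n : ℝ) * x ^ 2 = y ^ 2 := by
    rw [hx, div_pow, Real.sq_sqrt hn'.le]; field_simp
  have e : (n : ℂ) * (Complex.exp (Complex.I * x) - 1 - Complex.I * x) - (-(y ^ 2 / 2) : ℝ) =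
      n * (Complex.exp (Complex.I * x) - ∑ m ∈ Finset.range 3, (Complex.I * (x : ℂ)) ^ m / (m.factorial : ℂ)) := by
    rw [← hsq]
    simp [Finset.sum_range_succ, mul_pow, Nat.factorial]
    ring
  rw [e, norm_mul, Complex.norm_natCast]
  calc (n : ℝ) * _ ≤ n * (|x| ^ 3 * ((Nat.succ 3 : ℝ) * ((Nat.factorial 3 : ℝ) * (3 : ℕ))⁻¹)) := by
        gcongr
    _ ≤ n * (|x| ^ 3 * 1) := by gcongr; norm_num [Nat.factorial]
    _ = (n * x ^ 2) * |x| := by rw [← sq_abs x]; ring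
    _ = _ := by rw [hsq, hxa]

/-- The variance of the offspring distribution. -/
noncomputable def sigmaSq (p : ℕ → ℝ) : ℝ := ∑' j : ℕ, p j * ((j : ℝ) - 1) ^ 2

lemma summable_sigmaSq (hp : IsCritical p) : Summable fun j : ℕ => p j * ((j : ℝ) - 1) ^ 2 := by
  have := (hp.sq.sub (hp.mean.summable.mul_left 2)).add hp.sum.summable
  refine this.congr fun j => by ring

lemma sigmaSq_pos (hp : IsCritical p) : 0 < sigmaSq p :=
  hp.summable_sigmaSq.tsum_pos (fun j => mul_nonneg (hp.nonneg j) (sq_nonneg _)) 0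
    (by simpa using hp.zero_pos)

lemma tendsto_cf_pow (hp : IsCritical p) (u : ℝ) :
    Tendsto (fun n : ℕ => (cf p (u / Real.sqrt n) *
      Complex.exp (-(Complex.I * (u / Real.sqrt n : ℝ)))) ^ n) atTop
      (𝓝 (Real.exp (-(sigmaSq p * u ^ 2 / 2)) : ℝ)) := by
  have h1 : Tendsto (fun n : ℕ => ∑' j : ℕ, (p j : ℂ) * ((n : ℂ) *
      (Complex.exp (Complex.I * (u * (j - 1 : ℝ) / Real.sqrt n : ℝ)) - 1 -
      Complex.I * (u * (j - 1 : ℝ) / Real.sqrt n : ℝ)))) atTop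
      (𝓝 (∑' j : ℕ, (p j : ℂ) * ((-((u * (j - 1)) ^ 2 / 2) : ℝ) : ℂ))) := by
    refine tendsto_tsum_of_dominated_convergence (bound := fun j : ℕ => 3 * u ^ 2 * (p j * ((j : ℝ) - 1) ^ 2))
      (hp.summable_sigmaSq.mul_left _) (fun j => (tendsto_mul_exp_I_sub _).const_mul _) ?_
    filter_upwards [eventually_gt_atTop 0] with n hn j
    have hn' : (0 : ℝ) < n := by exact_mod_cast hn
    rw [norm_mul, norm_mul, Complex.norm_real, Complex.norm_natCast, Real.norm_of_nonneg (hp.nonneg j)]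
    calc p j * (n * _) ≤ p j * (n * (3 * (u * (j - 1) / Real.sqrt n) ^ 2)) := by
          gcongr
          · exact hp.nonneg j
          · exact norm_exp_I_sub_le _
      _ = _ := by rw [div_pow, Real.sq_sqrt hn'.le]; field_simp
  have h2 : ∑' j : ℕ, (p j : ℂ) * ((-((u * (j - 1)) ^ 2 / 2) : ℝ) : ℂ) =
      ((-(sigmaSq p * u ^ 2 / 2) : ℝ) : ℂ) := by
    rw [sigmaSq, mul_div_assoc, ← neg_mul, ← tsum_neg, ← tsum_mul_right, Complex.ofReal_tsum]
    refine tsum_congr fun j => ?_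
    push_cast; ring
  rw [h2] at h1
  have h3 : ∀ n : ℕ, ∑' j : ℕ, (p j : ℂ) * ((n : ℂ) *
      (Complex.exp (Complex.I * (u * (j - 1 : ℝ) / Real.sqrt n : ℝ)) - 1 -
      Complex.I * (u * (j - 1 : ℝ) / Real.sqrt n : ℝ))) =
      (n : ℂ) * (cf p (u / Real.sqrt n) * Complex.exp (-(Complex.I * (u / Real.sqrt n : ℝ))) - 1) := by
    intro n
    set x := u / Real.sqrt n with hx
    have a1 := (hp.summable_cf x).of_norm.hasSum.mul_right (Complex.exp (-(Complex.I * (x : ℝ))))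
    have a2 : HasSum (fun j : ℕ => (p j : ℂ)) ((1 : ℝ) : ℂ) := (Complex.hasSum_ofReal).2 hp.sum
    have a3 : HasSum (fun j : ℕ => (((j : ℝ) * p j - p j : ℝ) : ℂ)) ((1 - 1 : ℝ) : ℂ) :=
      (Complex.hasSum_ofReal).2 (hp.mean.sub hp.sum)
    have a4 := ((a1.sub a2).sub (a3.mul_right (Complex.I * x))).mul_left (n : ℂ)
    rw [← cf, sub_self, Complex.ofReal_zero, zero_mul, sub_zero, Complex.ofReal_one] at a4
    rw [← a4.tsum_eq]
    refine tsum_congr fun j => ?_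
    have e1 : ((u * (j - 1 : ℝ) / Real.sqrt n : ℝ) : ℂ) = x * (j - 1) := by
      rw [hx]; push_cast; ring
    have e2 : Complex.exp (Complex.I * (x * (j - 1))) =
        Complex.exp (Complex.I * ((x * j : ℝ) : ℂ)) * Complex.exp (-(Complex.I * (x : ℝ))) := by
      rw [← Complex.exp_add]; congr 1; push_cast; ring
    rw [e1, e2]
    push_cast
    ring
  simp_rw [h3] at h1
  have h4 := Complex.tendsto_one_add_pow_exp_of_tendsto h1
  rw [Complex.ofReal_exp]
  refine h4.congr fun n => ?_
  ring

/-- Lower bound in the local limit theorem, at a bounded distance from the mean. -/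
lemma exists_le_cpow (hp : IsCritical p) : ∃ h : ℕ, 0 < h ∧ (∀ i, p i ≠ 0 → h ∣ i) ∧
    ∃ c : ℝ, 0 < c ∧ ∃ N : ℕ, ∀ n : ℕ, N ≤ n → h ∣ n - 1 → c / Real.sqrt n ≤ cpow p n (n - 1) := by
  obtain ⟨h, hpos, hh, c, hc, H⟩ := hp.exists_norm_cf_pow_le
  have hpos' : (0 : ℝ) < h := by exact_mod_cast hpos
  have hpi := Real.pi_pos
  refine ⟨h, hpos, hh, ?_⟩
  set a := Real.pi / h with ha
  have ha0 : 0 < a := by positivity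
  let g : ℕ → ℝ → ℂ := fun n => (Set.Ioc (-a) a).indicator fun θ =>
    cf p θ ^ n * Complex.exp (-(Complex.I * (θ * (n - 1 : ℕ) : ℝ)))
  have hlim : Tendsto (fun n : ℕ => ∫ u, g n (u / Real.sqrt n)) atTop
      (𝓝 (∫ u : ℝ, ((Real.exp (-(sigmaSq p * u ^ 2 / 2)) : ℝ) : ℂ))) := by
    refine tendsto_integral_filter_of_dominated_convergence (fun u => Real.exp (-c * u ^ 2)) ?_ ?_
      (integrable_exp_neg_mul_sq hc) ?_
    · refine Eventually.of_forall fun n => ?_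
      have : Measurable (g n) := by
        refine Measurable.indicator ?_ measurableSet_Ioc
        have := hp.continuous_cf
        apply Continuous.measurable; fun_prop
      exact (this.comp (measurable_id.div_const _)).aestronglyMeasurable
    · filter_upwards [eventually_gt_atTop 0] with n hn
      refine Eventually.of_forall fun u => ?_
      have hn' : (0 : ℝ) < n := by exact_mod_cast hn
      by_cases hu : u / Real.sqrt n ∈ Set.Ioc (-a) a
      · simp only [g, Set.indicator_of_mem hu]
        rw [norm_mul, norm_pow, ← mul_neg, ← Complex.ofReal_neg, Complex.norm_exp_I_mul_ofReal, mul_one]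
        refine (H _ (abs_le.2 ⟨hu.1.le, hu.2⟩) n).trans (le_of_eq ?_)
        rw [div_pow, Real.sq_sqrt hn'.le]
        congr 1; field_simp
      · simp only [g, Set.indicator_of_notMem hu, norm_zero]
        exact (Real.exp_pos _).le
    · refine Eventually.of_forall fun u => ?_
      have hx : Tendsto (fun n : ℕ => u / Real.sqrt n) atTop (𝓝 0) :=
        tendsto_const_nhds.div_atTop (Real.tendsto_sqrt_atTop.comp tendsto_natCast_atTop_atTop)
      have hexp : Tendsto (fun n : ℕ => Complex.exp (Complex.I * (u / Real.sqrt n : ℝ))) atTop (𝓝 1) := by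
        have : Continuous fun x : ℝ => Complex.exp (Complex.I * (x : ℝ)) := by fun_prop
        have h := (this.tendsto 0).comp hx
        simp only [Complex.ofReal_zero, mul_zero, Complex.exp_zero] at h
        exact h
      have := (hp.tendsto_cf_pow u).mul hexp
      rw [mul_one] at this
      refine this.congr' ?_
      filter_upwards [hx.eventually (Ioc_mem_nhds (neg_lt_zero.2 ha0) ha0), eventually_gt_atTop 0]
        with n hn hn0
      have hn2 : u / Real.sqrt n ∈ Set.Ioc (-a) a := hn
      simp only [g, Set.indicator_of_mem hn2]
      rw [mul_pow, mul_assoc, ← Complex.exp_nat_mul, ← Complex.exp_add]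
      congr 2
      push_cast [Nat.cast_sub hn0]
      ring
  have hval : ∫ u : ℝ, ((Real.exp (-(sigmaSq p * u ^ 2 / 2)) : ℝ) : ℂ) =
      (Real.sqrt (Real.pi / (sigmaSq p / 2)) : ℝ) := by
    rw [integral_complex_ofReal, ← integral_gaussian]
    congr 2; funext u; congr 1; ring
  have hs := hp.sigmaSq_pos
  set L := Real.sqrt (Real.pi / (sigmaSq p / 2)) with hL
  have hL0 : 0 < L := Real.sqrt_pos.2 (by positivity)
  rw [hval] at hlim
  have hre := (Complex.continuous_re.tendsto _).comp hlim
  rw [Complex.ofReal_re] at hre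
  obtain ⟨N, hN⟩ := eventually_atTop.1 ((hre.eventually (lt_mem_nhds (half_lt_self hL0))).and
    (eventually_gt_atTop 0))
  refine ⟨h / (2 * Real.pi) * (L / 2), by positivity, N, fun n hn hdvd => ?_⟩
  obtain ⟨h1, hn0⟩ := hN n hn
  have hn' : (0 : ℝ) < n := by exact_mod_cast hn0
  have hsn : 0 < Real.sqrt n := Real.sqrt_pos.2 hn'
  have h2 := hp.integral_cf_pow hpos hh n (n - 1) hdvd
  rw [intervalIntegral.integral_of_le (by linarith), ← integral_indicator measurableSet_Ioc] at h2
  have h3 := Measure.integral_comp_div (g n) (Real.sqrt n)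
  simp only [Function.comp] at h1
  rw [h3, h2, abs_of_pos hsn, Complex.real_smul, ← Complex.ofReal_mul, ← Complex.ofReal_mul,
    Complex.ofReal_re] at h1
  rw [div_le_iff₀ hsn]
  calc h / (2 * Real.pi) * (L / 2) ≤ h / (2 * Real.pi) * (Real.sqrt n * (2 * Real.pi / h * cpow p n (n - 1))) := by
        gcongr
    _ = _ := by field_simp

end IsCritical

end

section

open Filter Topology MeasureTheory
open scoped ENNReal

namespace PTree

lemma size_node (ts : List PTree) : (node ts).size = 1 + (ts.map size).sum := by
  rw [size]; congr 2; exact List.attach_map_val (f := size) (l := ts)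

lemma height_node (ts : List PTree) : (node ts).height = (ts.map fun t => t.height + 1).foldr max 0 := by
  rw [height]; congr 1; exact List.attach_map_val (f := fun t => height t + 1) (l := ts)

lemma size_pos (T : PTree) : 0 < T.size := by
  cases T with | node ts => rw [size_node]; omega

/-- A tree is its list of root subtrees. -/
def equivList : PTree ≃ List PTree where
  toFun | node ts => ts
  invFun := node
  left_inv := fun ⟨_⟩ => rfl
  right_inv _ := rfl

/-- A tree given by its tuple of root subtrees. -/
def ofTuple {d : ℕ} (a : Fin d → PTree) : PTree := node (List.ofFn a)

lemma size_ofTuple {d : ℕ} (a : Fin d → PTree) : (ofTuple a).size = 1 + ∑ i, (a i).size := by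
  rw [ofTuple, size_node, List.map_ofFn, List.sum_ofFn]; rfl

lemma tsum_eq_tsum_ofTuple (f : PTree → ℝ≥0∞) :
    ∑' T, f T = ∑' d, ∑' a : Fin d → PTree, f (ofTuple a) := by
  rw [← (equivList.trans List.equivSigmaTuple).symm.tsum_eq, ENNReal.tsum_sigma']
  rfl

end PTree

lemma weight_node (p : ℕ → ℝ) (ts : List PTree) :
    weight p (.node ts) = p ts.length * (ts.map (weight p)).prod := by
  rw [weight]; congr 2; exact List.attach_map_val (f := weight p) (l := ts)

namespace ENNReal

lemma tsum_fin_succ {α : Type*} {d : ℕ} (f : (Fin (d + 1) → α) → ℝ≥0∞) :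
    ∑' a, f a = ∑' x, ∑' a : Fin d → α, f (Fin.cons x a) := by
  rw [← (Fin.consEquiv fun _ => α).tsum_eq, ENNReal.tsum_prod']
  rfl

lemma tsum_fin_zero {α : Type*} (f : (Fin 0 → α) → ℝ≥0∞) : ∑' a, f a = f Fin.elim0 := by
  rw [tsum_eq_single Fin.elim0]
  intro b hb; exact absurd (Subsingleton.elim _ _) hb

lemma tsum_fin_prod {α : Type*} {d : ℕ} (f : Fin d → α → ℝ≥0∞) :
    ∑' a : Fin d → α, ∏ i, f i (a i) = ∏ i, ∑' x, f i x := by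
  induction d with
  | zero => simp
  | succ d ih =>
    rw [tsum_fin_succ, Fin.prod_univ_succ, ← ih, ← ENNReal.tsum_mul_right]
    refine tsum_congr fun x => ?_
    rw [← ENNReal.tsum_mul_left]
    refine tsum_congr fun a => ?_
    rw [Fin.prod_univ_succ]
    simp

lemma tsum_fiber {α β : Type*} [DecidableEq β] (g : α → β) (f : α → ℝ≥0∞) :
    ∑' x, f x = ∑' y, ∑' x, if g x = y then f x else 0 := by
  rw [ENNReal.tsum_comm]
  refine tsum_congr fun x => ?_
  rw [tsum_eq_single (g x)]
  · simp
  · intro y hy; simp [hy.symm]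

end ENNReal

namespace GaltonWatson

variable {p : ℕ → ℝ}

/-- The weight of a tree, as an extended nonnegative real. -/
noncomputable def W (p : ℕ → ℝ) (T : PTree) : ℝ≥0∞ := ENNReal.ofReal (weight p T)

lemma weight_nonneg (hp : ∀ i, 0 ≤ p i) : ∀ T : PTree, 0 ≤ weight p T
  | .node ts => by
    rw [weight_node]
    refine mul_nonneg (hp _) (List.prod_nonneg ?_)
    intro x hx
    obtain ⟨t, ht, rfl⟩ := List.mem_map.1 hx
    have := List.sizeOf_lt_of_mem ht
    exact weight_nonneg hp t
decreasing_by simp only [PTree.node.sizeOf_spec]; omega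

lemma W_ofTuple (hp : ∀ i, 0 ≤ p i) {d : ℕ} (a : Fin d → PTree) :
    W p (PTree.ofTuple a) = ENNReal.ofReal (p d) * ∏ i, W p (a i) := by
  rw [W, PTree.ofTuple, weight_node, List.length_ofFn, ENNReal.ofReal_mul (hp d), List.map_ofFn,
    List.prod_ofFn, ENNReal.ofReal_prod_of_nonneg (f := weight p ∘ a) fun i _ => weight_nonneg hp _]
  rfl

/-- The total weight of the trees of size `n`. -/
noncomputable def treeMass (p : ℕ → ℝ) (n : ℕ) : ℝ≥0∞ := ∑' T : PTree, if T.size = n then W p T else 0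

/-- The total weight of the forests of `r` trees with `n` nodes in total. -/
noncomputable def forestMass (p : ℕ → ℝ) (r n : ℕ) : ℝ≥0∞ :=
  ∑' a : Fin r → PTree, if ∑ i, (a i).size = n then ∏ i, W p (a i) else 0

lemma tsum_tree (hp : ∀ i, 0 ≤ p i) (f : PTree → ℝ≥0∞) :
    ∑' T, W p T * f T =
      ∑' d, ENNReal.ofReal (p d) * ∑' a : Fin d → PTree, (∏ i, W p (a i)) * f (PTree.ofTuple a) := by
  rw [PTree.tsum_eq_tsum_ofTuple]
  refine tsum_congr fun d => ?_
  rw [← ENNReal.tsum_mul_left]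
  refine tsum_congr fun a => ?_
  rw [W_ofTuple hp, mul_assoc]

lemma treeMass_zero : treeMass p 0 = 0 := by
  rw [treeMass, ENNReal.tsum_eq_zero]
  intro T
  rw [if_neg T.size_pos.ne']

lemma treeMass_succ (hp : ∀ i, 0 ≤ p i) (n : ℕ) :
    treeMass p (n + 1) = ∑' d, ENNReal.ofReal (p d) * forestMass p d n := by
  have h1 : treeMass p (n + 1) = ∑' T : PTree, W p T * (if T.size = n + 1 then 1 else 0) := by
    rw [treeMass]; refine tsum_congr fun T => ?_; simp
  rw [h1, tsum_tree hp]
  refine tsum_congr fun d => ?_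
  rw [forestMass]
  congr 1
  refine tsum_congr fun a => ?_
  rw [PTree.size_ofTuple, add_comm 1]
  simp

lemma forestMass_zero (n : ℕ) : forestMass p 0 n = if n = 0 then 1 else 0 := by
  rw [forestMass, ENNReal.tsum_fin_zero]
  simp [eq_comm]

lemma forestMass_add (r s n : ℕ) :
    forestMass p (r + s) n =
      ∑ x ∈ Finset.HasAntidiagonal.antidiagonal n, forestMass p r x.1 * forestMass p s x.2 := by
  rw [forestMass, ← (Fin.appendEquiv r s).tsum_eq, ENNReal.tsum_prod']
  have h : ∀ x : ℕ × ℕ, forestMass p r x.1 * forestMass p s x.2 =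
      ∑' (a : Fin r → PTree), ∑' (b : Fin s → PTree),
        if ∑ i, (a i).size = x.1 ∧ ∑ i, (b i).size = x.2 then (∏ i, W p (a i)) * ∏ i, W p (b i) else 0 := by
    intro x
    rw [forestMass, forestMass, ← ENNReal.tsum_mul_right]
    refine tsum_congr fun a => ?_
    rw [← ENNReal.tsum_mul_left]
    refine tsum_congr fun b => ?_
    split_ifs <;> simp_all
  simp_rw [h]
  rw [← Summable.tsum_finsetSum fun _ _ => ENNReal.summable]
  refine tsum_congr fun a => ?_
  rw [← Summable.tsum_finsetSum fun _ _ => ENNReal.summable]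
  refine tsum_congr fun b => ?_
  have h1 : ∑ i, ((Fin.appendEquiv r s) (a, b) i).size = ∑ i, (a i).size + ∑ i, (b i).size := by
    simp [Fin.appendEquiv, Fin.sum_univ_add]
  have h2 : ∏ i, W p ((Fin.appendEquiv r s) (a, b) i) = (∏ i, W p (a i)) * ∏ i, W p (b i) := by
    simp [Fin.appendEquiv, Fin.prod_univ_add]
  rw [h1, h2]
  split_ifs with hn
  · rw [Finset.sum_eq_single (∑ i, (a i).size, ∑ i, (b i).size)]
    · simp
    · rintro ⟨x, y⟩ _ hxy
      rw [if_neg]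
      rintro ⟨rfl, rfl⟩
      exact hxy rfl
    · intro hx
      exact absurd (Finset.HasAntidiagonal.mem_antidiagonal.2 hn) hx
  · symm
    refine Finset.sum_eq_zero fun x hx => ?_
    rw [if_neg]
    rintro ⟨h3, h4⟩
    exact hn (by rw [h3, h4]; exact Finset.HasAntidiagonal.mem_antidiagonal.1 hx)

lemma forestMass_one (n : ℕ) : forestMass p 1 n = treeMass p n := by
  rw [forestMass, ENNReal.tsum_fin_succ, treeMass]
  refine tsum_congr fun T => ?_
  rw [ENNReal.tsum_fin_zero]
  simp

lemma forestMass_succ_zero (r : ℕ) : forestMass p (r + 1) 0 = 0 := by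
  rw [forestMass_add]
  simp [forestMass_one, treeMass_zero]

lemma forestMass_succ_succ (hp : ∀ i, 0 ≤ p i) (r n : ℕ) :
    forestMass p (r + 1) (n + 1) = ∑' s, ENNReal.ofReal (p s) * forestMass p (r + s) n := by
  rw [add_comm r 1, forestMass_add, Finset.Nat.antidiagonal_succ, Finset.sum_cons]
  simp only [forestMass_one, treeMass_zero, zero_mul, zero_add, Finset.sum_map,
    Function.Embedding.prodMap, Function.Embedding.coeFn_mk, Prod.map, Function.Embedding.refl_apply]
  simp only [Nat.succ_eq_add_one, treeMass_succ hp]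
  simp_rw [add_comm r, forestMass_add, Finset.mul_sum, ← ENNReal.tsum_mul_right]
  rw [Summable.tsum_finsetSum fun _ _ => ENNReal.summable]
  refine Finset.sum_congr rfl fun x _ => tsum_congr fun s => ?_
  rw [mul_assoc]

end GaltonWatson

namespace IsCritical
variable {p : ℕ → ℝ}

lemma sum_mul_cpow (n m : ℕ) :
    (n + 1 : ℝ) * ∑ x ∈ Finset.HasAntidiagonal.antidiagonal m, cpow p n x.1 * ((x.2 : ℝ) * p x.2) =
      m * cpow p (n + 1) m := by
  have h := (PowerSeries.derivative ℝ).leibniz_pow (PowerSeries.mk p) (n + 1)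
  have h2 := congrArg (fun f => PowerSeries.coeff m (PowerSeries.X * f)) h
  have hX : ∀ (f : PowerSeries ℝ) (j : ℕ), PowerSeries.coeff j (PowerSeries.X * PowerSeries.derivative ℝ f) =
      j * PowerSeries.coeff j f := by
    intro f j
    cases j with
    | zero => simp
    | succ j =>
      rw [PowerSeries.coeff_succ_X_mul, PowerSeries.coeff_derivative]
      push_cast; ring
  simp only [hX] at h2
  rw [cpow, h2, Nat.add_sub_cancel]
  have e : PowerSeries.X * ((n + 1) • PowerSeries.mk p ^ n • (PowerSeries.derivative ℝ) (PowerSeries.mk p)) =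
      (n + 1) • (PowerSeries.mk p ^ n * (PowerSeries.X * (PowerSeries.derivative ℝ) (PowerSeries.mk p))) := by
    simp only [smul_eq_mul, nsmul_eq_mul]; ring
  rw [e, map_nsmul, PowerSeries.coeff_mul, nsmul_eq_mul]
  push_cast
  simp [hX, cpow]

end IsCritical

end

section

open Filter Topology MeasureTheory
open scoped ENNReal
open Finset.HasAntidiagonal (antidiagonal mem_antidiagonal)
namespace IsCritical
variable {p : ℕ → ℝ}
open GaltonWatson

/-- Kemperman's formula (the cycle lemma). -/
lemma forestMass_eq (hp : IsCritical p) (n r : ℕ) : forestMass p r (n + 1) =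
    if r ≤ n + 1 then ENNReal.ofReal (r / (n + 1 : ℝ) * cpow p (n + 1) (n + 1 - r)) else 0 := by
  induction n generalizing r with
  | zero =>
    rcases r with _ | r
    · simp [forestMass_zero]
    rw [forestMass_succ_succ hp.nonneg, tsum_eq_single 0]
    · rcases r with _ | r
      · simp [forestMass_zero, cpow]
      · simp [forestMass_succ_zero]
    · rintro (_ | s) hs
      · exact absurd rfl hs
      · rw [← add_assoc, forestMass_succ_zero, mul_zero]
  | succ n ih =>
    rcases r with _ | r
    · simp [forestMass_zero]
    rw [forestMass_succ_succ hp.nonneg]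
    simp_rw [ih]
    split_ifs with hr
    swap
    · rw [ENNReal.tsum_eq_zero]
      intro s
      rw [if_neg (by omega), mul_zero]
    obtain ⟨m, hm⟩ : ∃ m, n + 1 = r + m := ⟨n + 1 - r, by omega⟩
    rw [show n + 1 + 1 - (r + 1) = m by omega]
    rw [tsum_eq_sum (s := Finset.range (m + 1))]
    swap
    · intro s hs
      rw [if_neg (by simp at hs; omega), mul_zero]
    have h1 : ∀ s ∈ Finset.range (m + 1), ENNReal.ofReal (p s) *
        (if r + s ≤ n + 1 then ENNReal.ofReal (((r + s : ℕ) : ℝ) / (n + 1 : ℝ) * cpow p (n + 1) (n + 1 - (r + s))) else 0)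
        = ENNReal.ofReal (p s * (((r + s : ℕ) : ℝ) / (n + 1 : ℝ) * cpow p (n + 1) (m - s))) := by
      intro s hs
      have hs' := Finset.mem_range.1 hs
      rw [if_pos (by omega), show n + 1 - (r + s) = m - s by omega, ENNReal.ofReal_mul (hp.nonneg s)]
    rw [Finset.sum_congr rfl h1, ← ENNReal.ofReal_sum_of_nonneg]
    swap
    · intro s _
      exact mul_nonneg (hp.nonneg s) (mul_nonneg (by positivity) (hp.cpow_nonneg _ _))
    congr 1
    have h2 := sum_mul_cpow (p := p) (n + 1) m
    have h3 := cpow_succ (p := p) (n + 1) m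
    rw [Finset.Nat.sum_antidiagonal_eq_sum_range_succ_mk, ← Finset.sum_range_reflect] at h2 h3
    set S := cpow p (n + 1 + 1) m
    have h4 : ∀ s ∈ Finset.range (m + 1), p s * (((r + s : ℕ) : ℝ) / (n + 1 : ℝ) * cpow p (n + 1) (m - s)) =
        (r / (n + 1 : ℝ)) * (cpow p (n + 1) (m + 1 - 1 - s) * p (m - (m + 1 - 1 - s))) +
        (1 / (n + 1 : ℝ)) * (cpow p (n + 1) (m + 1 - 1 - s) * (((m - (m + 1 - 1 - s) : ℕ) : ℝ) * p (m - (m + 1 - 1 - s)))) := by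
      intro s hs
      have hs' := Finset.mem_range.1 hs
      rw [show m - (m + 1 - 1 - s) = s by omega, show m + 1 - 1 - s = m - s by omega]
      push_cast
      ring
    rw [Finset.sum_congr rfl h4, Finset.sum_add_distrib, ← Finset.mul_sum, ← Finset.mul_sum]
    rw [← h3]
    have hn : (n : ℝ) + 1 + 1 ≠ 0 := by positivity
    push_cast at h2 ⊢
    have h5 := eq_div_of_mul_eq hn ((mul_comm _ _).trans h2)
    rw [h5]
    have hm' : (n : ℝ) + 1 = r + m := by exact_mod_cast hm
    have hn1 : (n : ℝ) + 1 ≠ 0 := by positivity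
    have hm2 : (m : ℝ) = n + 1 - r := by linarith
    rw [hm2]
    field_simp
    ring

lemma exists_forestMass_le (hp : IsCritical p) : ∃ C : ℝ, 0 < C ∧ ∀ r n : ℕ, 1 ≤ n →
    forestMass p r n ≤ ENNReal.ofReal (C * r / (n * Real.sqrt n)) := by
  obtain ⟨C, hC, H⟩ := hp.exists_cpow_le
  refine ⟨C, hC, fun r n hn => ?_⟩
  obtain ⟨n, rfl⟩ := Nat.exists_eq_add_of_le' hn
  rw [hp.forestMass_eq]
  split_ifs
  · refine ENNReal.ofReal_le_ofReal ?_
    calc _ ≤ r / (n + 1 : ℝ) * (C / Real.sqrt ((n + 1 : ℕ) : ℝ)) := by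
          gcongr; exact H _ (by omega) _
      _ = _ := by push_cast; field_simp
  · exact zero_le

lemma treeMass_eq (hp : IsCritical p) (n : ℕ) :
    treeMass p (n + 1) = ENNReal.ofReal (cpow p (n + 1) n / (n + 1)) := by
  rw [← forestMass_one, hp.forestMass_eq, if_pos (by omega)]
  congr 1; simp; ring

lemma treeMass_ne_top (hp : IsCritical p) (n : ℕ) : treeMass p n ≠ ∞ := by
  rcases n with _ | n
  · simp [treeMass_zero]
  · rw [hp.treeMass_eq]; exact ENNReal.ofReal_ne_top

/-- There is a lattice of possible sizes, along which tree masses have order `n ^ (-3/2)`. -/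
lemma exists_le_treeMass (hp : IsCritical p) : ∃ h : ℕ, 0 < h ∧ (∀ i, p i ≠ 0 → h ∣ i) ∧
    (∀ n, treeMass p n ≠ 0 → h ∣ n - 1) ∧
    ∃ c : ℝ, 0 < c ∧ ∃ N : ℕ, ∀ n : ℕ, N ≤ n → h ∣ n - 1 →
      ENNReal.ofReal (c / (n * Real.sqrt n)) ≤ treeMass p n := by
  obtain ⟨h, hpos, hh, c, hc, N, H⟩ := hp.exists_le_cpow
  refine ⟨h, hpos, hh, fun n hn => ?_, c, hc, N + 1, fun n hn hd => ?_⟩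
  · rcases n with _ | n
    · simp
    rw [hp.treeMass_eq] at hn
    refine dvd_of_cpow_ne_zero hh (n + 1) n fun h0 => hn ?_
    simp [h0]
  · obtain ⟨m, rfl⟩ := Nat.exists_eq_add_of_le' (show 1 ≤ n by omega)
    rw [hp.treeMass_eq]
    refine ENNReal.ofReal_le_ofReal ?_
    have := H (m + 1) (by omega) hd
    rw [Nat.add_sub_cancel] at this
    have hm : (0 : ℝ) < m + 1 := by positivity
    rw [le_div_iff₀ hm]
    refine le_trans (le_of_eq ?_) this
    push_cast
    field_simp

/-- Tree masses are bounded below on their support. -/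
lemma exists_le_treeMass_of_ne_zero (hp : IsCritical p) : ∃ c : ℝ, 0 < c ∧ ∀ n : ℕ,
    treeMass p n ≠ 0 → ENNReal.ofReal (c / (n * Real.sqrt n)) ≤ treeMass p n := by
  obtain ⟨h, hpos, hh, hs, c, hc, N, H⟩ := hp.exists_le_treeMass
  have key : ∀ M : ℕ, ∃ c' : ℝ, 0 < c' ∧ ∀ n < M, treeMass p n ≠ 0 →
      ENNReal.ofReal (c' / (n * Real.sqrt n)) ≤ treeMass p n := by
    intro M
    induction M with
    | zero => exact ⟨1, one_pos, by simp⟩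
    | succ M ih =>
      obtain ⟨c', hc', h'⟩ := ih
      by_cases h0 : treeMass p M = 0
      · refine ⟨c', hc', fun n hn hne => ?_⟩
        rcases Nat.lt_succ_iff_lt_or_eq.1 hn with h1 | rfl
        · exact h' n h1 hne
        · exact absurd h0 hne
      · have hM : 0 < (M : ℝ) := by
          rcases M with _ | M
          · exact absurd treeMass_zero h0
          · positivity
        have h1 : 0 < (treeMass p M).toReal := ENNReal.toReal_pos h0 (hp.treeMass_ne_top M)
        refine ⟨min c' ((treeMass p M).toReal * (M * Real.sqrt M)), by positivity, fun n hn hne => ?_⟩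
        rcases Nat.lt_succ_iff_lt_or_eq.1 hn with h2 | rfl
        · refine le_trans (ENNReal.ofReal_le_ofReal ?_) (h' n h2 hne)
          gcongr; exact min_le_left _ _
        · rw [← ENNReal.ofReal_toReal (hp.treeMass_ne_top n)]
          refine ENNReal.ofReal_le_ofReal ?_
          rw [div_le_iff₀ (by positivity), ENNReal.ofReal_toReal (hp.treeMass_ne_top n)]
          exact min_le_right _ _
  obtain ⟨c', hc', h'⟩ := key N
  refine ⟨min c c', lt_min hc hc', fun n hne => ?_⟩
  rcases lt_or_ge n N with hn | hn
  · refine le_trans (ENNReal.ofReal_le_ofReal ?_) (h' n hn hne)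
    gcongr; exact min_le_right _ _
  · refine le_trans (ENNReal.ofReal_le_ofReal ?_) (H n hn (hs n hne))
    gcongr; exact min_le_left _ _

end IsCritical

end

section

open Filter Topology MeasureTheory
open scoped ENNReal

namespace IsCritical
variable {p : ℕ → ℝ}
open GaltonWatson

section GeneratingFunction

lemma one_sub_pow_le {u : ℝ} (h0 : 0 ≤ u) (h1 : u ≤ 1) (d : ℕ) :
    (1 - u) ^ d ≤ 1 - d * u + (d : ℝ) ^ 2 * u ^ 2 := by
  induction d with
  | zero => simp
  | succ d ih =>
    rw [pow_succ]
    have := mul_le_mul_of_nonneg_right ih (sub_nonneg.2 h1)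
    push_cast
    have hd : (0 : ℝ) ≤ d := d.cast_nonneg
    nlinarith [mul_nonneg hd (sq_nonneg u), mul_nonneg (mul_nonneg hd hd) (pow_nonneg h0 3),
      sq_nonneg u]

lemma le_one_sub_pow {u : ℝ} (h1 : u ≤ 1) {d : ℕ} (hd : 2 ≤ d) :
    1 - d * u + u ^ 2 ≤ (1 - u) ^ d := by
  induction d, hd using Nat.le_induction with
  | base => apply le_of_eq; push_cast; ring
  | succ d hd ih =>
    rw [pow_succ (1 - u)]
    have := mul_le_mul_of_nonneg_right ih (sub_nonneg.2 h1)
    push_cast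
    have hd : (1 : ℝ) ≤ d := by exact_mod_cast (by omega : 1 ≤ d)
    nlinarith [mul_nonneg (sq_nonneg u) (sub_nonneg.2 h1), mul_nonneg (sq_nonneg u) (sub_nonneg.2 hd)]

/-- The probability generating function of the offspring law. -/
noncomputable def phi (p : ℕ → ℝ) (y : ℝ) : ℝ := ∑' d, p d * y ^ d

lemma summable_phi (hp : IsCritical p) {y : ℝ} (h0 : 0 ≤ y) (h1 : y ≤ 1) :
    Summable fun d => p d * y ^ d :=
  hp.sum.summable.of_nonneg_of_le (fun d => mul_nonneg (hp.nonneg d) (pow_nonneg h0 d))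
    fun d => mul_le_of_le_one_right (hp.nonneg d) (pow_le_one₀ h0 h1)

lemma phi_le_one (hp : IsCritical p) {y : ℝ} (h0 : 0 ≤ y) (h1 : y ≤ 1) : phi p y ≤ 1 := by
  rw [phi, ← hp.sum.tsum_eq]
  exact (hp.summable_phi h0 h1).tsum_le_tsum
    (fun d => mul_le_of_le_one_right (hp.nonneg d) (pow_le_one₀ h0 h1)) hp.sum.summable

lemma zero_le_phi (hp : IsCritical p) {y : ℝ} (h0 : 0 ≤ y) : 0 ≤ phi p y :=
  tsum_nonneg fun d => mul_nonneg (hp.nonneg d) (pow_nonneg h0 d)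

lemma atom_le_phi (hp : IsCritical p) {y : ℝ} (h0 : 0 ≤ y) (h1 : y ≤ 1) : p 0 ≤ phi p y := by
  have := (hp.summable_phi h0 h1).le_tsum 0 fun d _ => mul_nonneg (hp.nonneg d) (pow_nonneg h0 d)
  simpa [phi] using this

lemma hasSum_phi_sub (hp : IsCritical p) {u : ℝ} (h0 : 0 ≤ u) (h1 : u ≤ 1) :
    HasSum (fun d : ℕ => p d * ((1 - u) ^ d - 1 + d * u)) (phi p (1 - u) - 1 + u) := by
  have h := ((hp.summable_phi (sub_nonneg.2 h1) (sub_le_self 1 h0)).hasSum.sub hp.sum).add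
    (hp.mean.mul_right u)
  rw [one_mul] at h
  refine h.congr_fun ?_ |> fun h => h
  intro d; ring

lemma phi_le (hp : IsCritical p) {u : ℝ} (h0 : 0 ≤ u) (h1 : u ≤ 1) :
    phi p (1 - u) - (1 - u) ≤ (∑' i : ℕ, (i : ℝ) ^ 2 * p i) * u ^ 2 := by
  have := hasSum_le (fun d => ?_) (hp.hasSum_phi_sub h0 h1) (hp.sq.hasSum.mul_right (u ^ 2))
  · linarith
  · have := mul_le_mul_of_nonneg_left (one_sub_pow_le h0 h1 d) (hp.nonneg d)
    nlinarith

lemma le_phi (hp : IsCritical p) {u : ℝ} (h0 : 0 ≤ u) (h1 : u ≤ 1) {d : ℕ} (hd : 2 ≤ d) :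
    p d * u ^ 2 ≤ phi p (1 - u) - (1 - u) := by
  have h : p d * ((1 - u) ^ d - 1 + d * u) ≤ phi p (1 - u) - 1 + u := by
    refine le_hasSum (hp.hasSum_phi_sub h0 h1) d fun j _ => mul_nonneg (hp.nonneg j) ?_
    have := one_add_mul_le_pow (a := -u) (by linarith) j
    rw [← sub_eq_add_neg] at this
    linarith
  have := mul_le_mul_of_nonneg_left (le_one_sub_pow h1 hd) (hp.nonneg d)
  nlinarith

/-- The generating function of the tree sizes. -/
noncomputable def sizeGF (p : ℕ → ℝ) (x : ℝ≥0∞) : ℝ≥0∞ := ∑' T : PTree, W p T * x ^ T.size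

/-- The generating function of the sizes of the trees of height less than `j`. -/
noncomputable def sizeGFLT (p : ℕ → ℝ) (j : ℕ) (x : ℝ≥0∞) : ℝ≥0∞ :=
  ∑' T : PTree, W p T * (if T.height < j then x ^ T.size else 0)

/-- The generating function of the sizes of the trees of height at least `j`. -/
noncomputable def sizeGFGE (p : ℕ → ℝ) (j : ℕ) (x : ℝ≥0∞) : ℝ≥0∞ :=
  ∑' T : PTree, W p T * (if j ≤ T.height then x ^ T.size else 0)

lemma sizeGF_eq (hp : IsCritical p) (x : ℝ≥0∞) :
    sizeGF p x = x * ∑' d, ENNReal.ofReal (p d) * sizeGF p x ^ d := by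
  conv_lhs => rw [sizeGF, tsum_tree hp.nonneg]
  rw [← ENNReal.tsum_mul_left]
  refine tsum_congr fun d => ?_
  rw [mul_left_comm]
  congr 1
  rw [← Fin.prod_const, sizeGF, ← ENNReal.tsum_fin_prod (fun _ T => W p T * x ^ T.size),
    ← ENNReal.tsum_mul_left]
  refine tsum_congr fun a => ?_
  rw [PTree.size_ofTuple, pow_add, pow_one, Finset.prod_mul_distrib, Finset.prod_pow_eq_pow_sum]
  ring

lemma height_ofTuple_lt {d : ℕ} (a : Fin d → PTree) (j : ℕ) :
    (PTree.ofTuple a).height < j + 1 ↔ ∀ i, (a i).height < j := by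
  rw [PTree.ofTuple, PTree.height_node]
  have : ∀ l : List PTree, (l.map fun t => t.height + 1).foldr max 0 < j + 1 ↔
      ∀ t ∈ l, t.height < j := by
    intro l
    induction l with
    | nil => simp
    | cons t l ih =>
      rw [List.map_cons, List.foldr_cons, max_lt_iff, ih]
      simp
  rw [this]
  simp [List.mem_ofFn]

lemma sizeGFLT_succ (hp : IsCritical p) (j : ℕ) (x : ℝ≥0∞) :
    sizeGFLT p (j + 1) x = x * ∑' d, ENNReal.ofReal (p d) * sizeGFLT p j x ^ d := by
  rw [sizeGFLT, tsum_tree hp.nonneg, ← ENNReal.tsum_mul_left]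
  refine tsum_congr fun d => ?_
  rw [mul_left_comm]
  congr 1
  rw [← Fin.prod_const, sizeGFLT, ← ENNReal.tsum_fin_prod
    (fun _ T => W p T * (if T.height < j then x ^ T.size else 0)), ← ENNReal.tsum_mul_left]
  refine tsum_congr fun a => ?_
  simp_rw [height_ofTuple_lt]
  by_cases h : ∀ i, (a i).height < j
  · simp_rw [if_pos h, h, if_true]
    rw [PTree.size_ofTuple, pow_add, pow_one, Finset.prod_mul_distrib, Finset.prod_pow_eq_pow_sum]
    ring
  · rw [if_neg h]
    push Not at h
    obtain ⟨i, hi⟩ := h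
    have h0 : W p (a i) * (if (a i).height < j then x ^ (a i).size else 0) = 0 := by
      rw [if_neg hi.not_gt, mul_zero]
    have h1 : ∏ i, W p (a i) * (if (a i).height < j then x ^ (a i).size else 0) = 0 :=
      Finset.prod_eq_zero (Finset.mem_univ i) h0
    rw [h1, mul_zero, mul_zero]

lemma sizeGF_le_sizeGF_one {x : ℝ≥0∞} (hx : x ≤ 1) : sizeGF p x ≤ sizeGF p 1 := by
  refine ENNReal.tsum_le_tsum fun T => ?_
  gcongr

lemma sizeGFLT_one_le_one (hp : IsCritical p) (j : ℕ) : sizeGFLT p j 1 ≤ 1 := by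
  induction j with
  | zero => simp [sizeGFLT]
  | succ j ih =>
    rw [hp.sizeGFLT_succ, one_mul]
    calc _ ≤ ∑' d, ENNReal.ofReal (p d) := ENNReal.tsum_le_tsum fun d =>
          mul_le_of_le_one_right' (pow_le_one' ih d)
      _ = 1 := by
        rw [← ENNReal.ofReal_tsum_of_nonneg hp.nonneg hp.sum.summable, hp.sum.tsum_eq,
          ENNReal.ofReal_one]

lemma sizeGF_one_le_one (hp : IsCritical p) : sizeGF p 1 ≤ 1 := by
  rw [sizeGF, ENNReal.tsum_eq_iSup_sum]
  refine iSup_le fun s => ?_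
  refine le_trans ?_ (hp.sizeGFLT_one_le_one (s.sup PTree.height + 1))
  refine le_trans (Finset.sum_le_sum fun T hT => ?_) (ENNReal.sum_le_tsum s)
  rw [if_pos (Nat.lt_succ_of_le (Finset.le_sup hT))]

lemma sizeGF_le_one (hp : IsCritical p) {x : ℝ≥0∞} (hx : x ≤ 1) : sizeGF p x ≤ 1 :=
  (sizeGF_le_sizeGF_one hx).trans hp.sizeGF_one_le_one

lemma sizeGFLT_add_sizeGFGE (j : ℕ) (x : ℝ≥0∞) :
    sizeGFLT p j x + sizeGFGE p j x = sizeGF p x := by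
  rw [sizeGFLT, sizeGFGE, ← ENNReal.tsum_add, sizeGF]
  refine tsum_congr fun T => ?_
  by_cases h : T.height < j
  · rw [if_pos h, if_neg h.not_ge]; simp
  · rw [if_neg h, if_pos (not_lt.1 h)]; simp

/-- The series defining `phi`, in extended nonnegative reals. -/
lemma tsum_ofReal_mul_pow (hp : IsCritical p) {y : ℝ≥0∞} (hy : y ≤ 1) :
    ∑' d, ENNReal.ofReal (p d) * y ^ d = ENNReal.ofReal (phi p y.toReal) := by
  have hytop : y ≠ ∞ := ne_top_of_le_ne_top ENNReal.one_ne_top hy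
  have h1 : y.toReal ≤ 1 := ENNReal.toReal_le_of_le_ofReal zero_le_one (by simpa using hy)
  rw [phi, ENNReal.ofReal_tsum_of_nonneg
    (fun d => mul_nonneg (hp.nonneg d) (pow_nonneg ENNReal.toReal_nonneg d))
    (hp.summable_phi ENNReal.toReal_nonneg h1)]
  refine tsum_congr fun d => ?_
  rw [ENNReal.ofReal_mul (hp.nonneg d), ENNReal.ofReal_pow ENNReal.toReal_nonneg,
    ENNReal.ofReal_toReal hytop]

/-- The tail of the height of a critical Galton-Watson tree. -/
lemma exists_sizeGFGE_one_le (hp : IsCritical p) : ∃ c : ℝ, 0 < c ∧ c ≤ 1 ∧ ∀ j : ℕ,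
    sizeGFGE p j 1 ≤ ENNReal.ofReal (1 / (1 + c * j)) := by
  obtain ⟨d, hd, hpd⟩ := hp.exists_two_le_pos
  have hpd1 : p d ≤ 1 := le_hasSum hp.sum d fun j _ => hp.nonneg j
  refine ⟨p d, hpd, hpd1, fun j => ?_⟩
  have key : 1 - (sizeGFLT p j 1).toReal ≤ 1 / (1 + p d * j) := by
    induction j with
    | zero => simp
    | succ j ih =>
      set y := (sizeGFLT p j 1).toReal with hy
      have h1 : y ≤ 1 :=
        ENNReal.toReal_le_of_le_ofReal zero_le_one (by simpa using hp.sizeGFLT_one_le_one j)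
      have h0 : 0 ≤ y := ENNReal.toReal_nonneg
      rw [hp.sizeGFLT_succ, one_mul, hp.tsum_ofReal_mul_pow (hp.sizeGFLT_one_le_one j), ← hy,
        ENNReal.toReal_ofReal (hp.zero_le_phi h0)]
      have h := hp.le_phi (u := 1 - y) (by linarith) (by linarith) hd
      rw [sub_sub_cancel] at h
      have hj : (0 : ℝ) ≤ p d * j := by positivity
      rw [le_div_iff₀ (by positivity)] at ih
      rw [le_div_iff₀ (by positivity)]
      push_cast
      set u := 1 - y with hu
      have hu0 : 0 ≤ u := by linarith
      have h3 : 1 - phi p y ≤ u - p d * u ^ 2 := by linarith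
      have h4 : (1 - phi p y) * (1 + p d * (j + 1)) ≤ (u - p d * u ^ 2) * (1 + p d * (j + 1)) :=
        mul_le_mul_of_nonneg_right h3 (by positivity)
      have h5 : 0 ≤ 1 - p d * u := by nlinarith
      have h6 : (1 - p d * u) * (u * (1 + p d * j) + p d * u) ≤ (1 - p d * u) * (1 + p d * u) :=
        mul_le_mul_of_nonneg_left (by linarith) h5
      nlinarith [sq_nonneg (p d * u)]
  have hle := hp.sizeGF_one_le_one
  rw [← sizeGFLT_add_sizeGFGE j] at hle
  have hne : sizeGFLT p j 1 ≠ ∞ := ne_top_of_le_ne_top ENNReal.one_ne_top (hp.sizeGFLT_one_le_one j)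
  have : sizeGFGE p j 1 ≤ 1 - sizeGFLT p j 1 := ENNReal.le_sub_of_add_le_left hne hle
  refine this.trans ?_
  have e : (1 : ℝ≥0∞) - sizeGFLT p j 1 = ENNReal.ofReal (1 - (sizeGFLT p j 1).toReal) := by
    rw [ENNReal.ofReal_sub _ ENNReal.toReal_nonneg, ENNReal.ofReal_toReal hne, ENNReal.ofReal_one]
  rw [e]
  exact ENNReal.ofReal_le_ofReal key

/-- The behaviour of the size generating function near `1`. -/
lemma exists_one_sub_sizeGF (hp : IsCritical p) : ∃ c C : ℝ, 0 < c ∧ 0 < C ∧ ∀ x : ℝ, 0 ≤ x → x ≤ 1 →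
    c * √(1 - x) ≤ 1 - (sizeGF p (ENNReal.ofReal x)).toReal ∧
      1 - (sizeGF p (ENNReal.ofReal x)).toReal ≤ C * √(1 - x) := by
  obtain ⟨d, hd, hpd⟩ := hp.exists_two_le_pos
  set K := ∑' i : ℕ, (i : ℝ) ^ 2 * p i with hK
  have hK0 : 0 < K := zero_lt_one.trans hp.var
  have hp0 := hp.zero_pos
  refine ⟨√(p 0 / K), √(1 / p d), by positivity, by positivity, fun x h0 h1 => ?_⟩
  have hx1 : ENNReal.ofReal x ≤ 1 := by simpa using h1
  have hg := hp.sizeGF_le_one hx1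
  set y := (sizeGF p (ENNReal.ofReal x)).toReal with hy
  have hy1 : y ≤ 1 := ENNReal.toReal_le_of_le_ofReal zero_le_one (by simpa using hg)
  have hy0 : 0 ≤ y := ENNReal.toReal_nonneg
  have hrec : y = x * phi p y := by
    conv_lhs => rw [hy, sizeGF_eq hp]
    rw [hp.tsum_ofReal_mul_pow hg, ← hy, ENNReal.toReal_mul,
      ENNReal.toReal_ofReal h0, ENNReal.toReal_ofReal (hp.zero_le_phi hy0)]
  have l1 := hp.phi_le (u := 1 - y) (by linarith) (by linarith)
  have l2 := hp.le_phi (u := 1 - y) (by linarith) (by linarith) hd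
  rw [sub_sub_cancel] at l1 l2
  have e1 : phi p y - y = (1 - x) * phi p y := by linarith
  have l3 := hp.atom_le_phi hy0 hy1
  have l4 := hp.phi_le_one hy0 hy1
  have hx0 : 0 ≤ 1 - x := by linarith
  constructor
  · rw [← Real.sqrt_mul (by positivity)]
    apply Real.sqrt_le_iff.2 ⟨by linarith, ?_⟩
    rw [div_mul_eq_mul_div, div_le_iff₀ hK0]
    nlinarith
  · rw [← Real.sqrt_mul (by positivity)]
    apply Real.le_sqrt_of_sq_le
    rw [one_div_mul_eq_div, le_div_iff₀ hpd]
    nlinarith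

end GeneratingFunction

end IsCritical

end

section

open Filter Topology MeasureTheory
open scoped ENNReal

namespace IsCritical
variable {p : ℕ → ℝ}
open GaltonWatson

/-- The total weight of the trees with at least `x` nodes. -/
noncomputable def tailMass (p : ℕ → ℝ) (x : ℝ) : ℝ≥0∞ :=
  ∑' T : PTree, if x ≤ T.size then W p T else 0

lemma tailMass_le_one (hp : IsCritical p) (x : ℝ) : tailMass p x ≤ 1 := by
  refine le_trans (ENNReal.tsum_le_tsum fun T => ?_) hp.sizeGF_one_le_one
  split_ifs <;> simp

lemma exists_tailMass_le (hp : IsCritical p) : ∃ C : ℝ, 0 < C ∧ ∀ x : ℝ, 0 < x →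
    tailMass p x ≤ ENNReal.ofReal (C / √x) := by
  obtain ⟨c, C, -, hC, H⟩ := hp.exists_one_sub_sizeGF
  refine ⟨2 * C + 1, by positivity, fun x hx => ?_⟩
  have hsx : 0 < √x := Real.sqrt_pos.2 hx
  rcases le_total x 1 with h1 | h1
  · refine (hp.tailMass_le_one x).trans ?_
    rw [← ENNReal.ofReal_one]
    apply ENNReal.ofReal_le_ofReal
    rw [one_le_div hsx]
    have : √x ≤ 1 := Real.sqrt_le_one.2 h1
    linarith
  · set z : ℝ := 1 - 1 / x with hz
    have hx1 : 1 / x ≤ 1 := by rw [div_le_one hx]; exact h1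
    have hx0 : 0 < 1 / x := by positivity
    have hz0 : 0 ≤ z := by linarith
    have hz1 : z ≤ 1 := by linarith
    have hzp : ∀ N : ℕ, x ≤ N → z ^ N ≤ 1 / 2 := by
      intro N hN
      have h2 : z ≤ Real.exp (-(1 / x)) := by
        have := Real.add_one_le_exp (-(1 / x)); linarith
      calc z ^ N ≤ Real.exp (-(1 / x)) ^ N := by gcongr
        _ = Real.exp (-(N / x)) := by rw [← Real.exp_nat_mul]; congr 1; ring
        _ ≤ Real.exp (-1) := by
          gcongr
          rw [le_div_iff₀ hx]; linarith
        _ ≤ 1 / 2 := by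
          rw [Real.exp_neg, one_div]
          gcongr
          have := Real.add_one_le_exp (1 : ℝ); linarith
    have hz1' : ENNReal.ofReal z ≤ 1 := by simpa using hz1
    have hsum : tailMass p x * ENNReal.ofReal (1 / 2) + sizeGF p (ENNReal.ofReal z) ≤ 1 := by
      refine le_trans ?_ hp.sizeGF_one_le_one
      rw [tailMass, sizeGF, sizeGF, ← ENNReal.tsum_mul_right, ← ENNReal.tsum_add]
      refine ENNReal.tsum_le_tsum fun T => ?_
      split_ifs with h
      · rw [← mul_add]
        gcongr
        rw [one_pow, ← ENNReal.ofReal_pow hz0, ← ENNReal.ofReal_add (by norm_num) (by positivity)]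
        rw [← ENNReal.ofReal_one]
        apply ENNReal.ofReal_le_ofReal
        linarith [hzp _ h]
      · rw [zero_mul, zero_add]
        gcongr
    have hne : tailMass p x ≠ ∞ := ne_top_of_le_ne_top ENNReal.one_ne_top (hp.tailMass_le_one x)
    have hne2 : sizeGF p (ENNReal.ofReal z) ≠ ∞ :=
      ne_top_of_le_ne_top ENNReal.one_ne_top (hp.sizeGF_le_one hz1')
    have hreal := ENNReal.toReal_mono ENNReal.one_ne_top hsum
    rw [ENNReal.toReal_add (ENNReal.mul_ne_top hne ENNReal.ofReal_ne_top) hne2, ENNReal.toReal_mul,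
      ENNReal.toReal_ofReal (by norm_num), ENNReal.toReal_one] at hreal
    have h3 := (H z hz0 hz1).2
    have e : 1 - z = 1 / x := by rw [hz]; ring
    rw [e, Real.sqrt_div zero_le_one, Real.sqrt_one, mul_one_div] at h3
    rw [← ENNReal.ofReal_toReal hne]
    apply ENNReal.ofReal_le_ofReal
    calc (tailMass p x).toReal ≤ 2 * (C / √x) := by linarith
      _ = 2 * C / √x := by ring
      _ ≤ _ := by gcongr; linarith

lemma sizeGFGE_succ_le (hp : IsCritical p) (j : ℕ) (x : ℝ≥0∞) :
    sizeGFGE p (j + 1) x ≤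
      x * (∑' d : ℕ, ENNReal.ofReal (p d) * (d * sizeGF p x ^ (d - 1))) * sizeGFGE p j x := by
  rw [sizeGFGE, tsum_tree hp.nonneg, ← ENNReal.tsum_mul_left, ← ENNReal.tsum_mul_right]
  refine ENNReal.tsum_le_tsum fun d => ?_
  rw [mul_left_comm, mul_assoc]
  gcongr
  have key : ∀ i : Fin d, ∑' a : Fin d → PTree, (∏ l, W p (a l)) *
      (if j ≤ (a i).height then x ^ (PTree.ofTuple a).size else 0) =
      x * (sizeGFGE p j x * sizeGF p x ^ (d - 1)) := by
    intro i
    have e : sizeGFGE p j x * sizeGF p x ^ (d - 1) =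
        ∏ l : Fin d, ∑' T, if l = i then W p T * (if j ≤ T.height then x ^ T.size else 0)
          else W p T * x ^ T.size := by
      have : ∀ l : Fin d, (∑' T, if l = i then W p T * (if j ≤ T.height then x ^ T.size else 0)
          else W p T * x ^ T.size) = if l = i then sizeGFGE p j x else sizeGF p x := by
        intro l; split_ifs <;> rfl
      simp_rw [this]
      rw [Finset.prod_ite, Finset.prod_const, Finset.prod_const, Finset.filter_eq']
      simp [Finset.filter_ne', Finset.card_erase_of_mem]
    rw [e, ← ENNReal.tsum_fin_prod (fun (l : Fin d) T => if l = i then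
      W p T * (if j ≤ T.height then x ^ T.size else 0) else W p T * x ^ T.size),
      ← ENNReal.tsum_mul_left]
    refine tsum_congr fun a => ?_
    have e2 : ∀ l, (if l = i then W p (a l) * (if j ≤ (a l).height then x ^ (a l).size else 0)
          else W p (a l) * x ^ (a l).size) =
          W p (a l) * (x ^ (a l).size * (if l = i then (if j ≤ (a i).height then 1 else 0) else 1)) := by
      intro l
      by_cases hl : l = i
      · subst hl; simp
      · simp [hl]
    simp_rw [e2]
    rw [Finset.prod_mul_distrib, Finset.prod_mul_distrib, Finset.prod_pow_eq_pow_sum,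
      Finset.prod_ite_eq' , if_pos (Finset.mem_univ _), PTree.size_ofTuple, pow_add, pow_one]
    split_ifs
    · ring
    · simp
  calc ∑' a : Fin d → PTree, (∏ i, W p (a i)) *
        (if j + 1 ≤ (PTree.ofTuple a).height then x ^ (PTree.ofTuple a).size else 0)
      ≤ ∑' a : Fin d → PTree, ∑ i, (∏ l, W p (a l)) *
        (if j ≤ (a i).height then x ^ (PTree.ofTuple a).size else 0) := by
        refine ENNReal.tsum_le_tsum fun a => ?_
        rw [← Finset.mul_sum]
        gcongr
        split_ifs with h
        · have : ∃ i, j ≤ (a i).height := by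
            by_contra! hcon
            exact absurd ((height_ofTuple_lt a j).2 hcon) h.not_gt
          obtain ⟨i, hi⟩ := this
          refine le_trans ?_ (Finset.single_le_sum (fun _ _ => zero_le) (Finset.mem_univ i))
          rw [if_pos hi]
        · exact zero_le
    _ = ∑ i : Fin d, x * (sizeGFGE p j x * sizeGF p x ^ (d - 1)) := by
        rw [Summable.tsum_finsetSum fun _ _ => ENNReal.summable]
        exact Finset.sum_congr rfl fun i _ => key i
    _ = x * (d * sizeGF p x ^ (d - 1) * sizeGFGE p j x) := by
        rw [Finset.sum_const, Finset.card_univ, Fintype.card_fin, nsmul_eq_mul]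
        ring
    _ ≤ _ := by rw [← mul_assoc]

lemma exists_sizeGFGE_succ_le (hp : IsCritical p) : ∃ c : ℝ, 0 < c ∧ ∀ x : ℝ, 0 ≤ x → x ≤ 1 →
    c * √(1 - x) ≤ 1 ∧ ∀ j, sizeGFGE p (j + 1) (ENNReal.ofReal x) ≤
      ENNReal.ofReal (1 - c * √(1 - x)) * sizeGFGE p j (ENNReal.ofReal x) := by
  obtain ⟨d, hd, hpd⟩ := hp.exists_two_le_pos
  obtain ⟨c, C, hc, -, H⟩ := hp.exists_one_sub_sizeGF
  have hd0 : (0 : ℝ) < d := by exact_mod_cast (by omega : 0 < d)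
  have hpd1 : d * p d ≤ 1 :=
    le_hasSum hp.mean d fun j _ => mul_nonneg j.cast_nonneg (hp.nonneg j)
  refine ⟨d * p d * c, by positivity, fun x h0 h1 => ?_⟩
  have hx1 : ENNReal.ofReal x ≤ 1 := by simpa using h1
  have hg := hp.sizeGF_le_one hx1
  have hH := (H x h0 h1).1
  have hgne : sizeGF p (ENNReal.ofReal x) ≠ ∞ := ne_top_of_le_ne_top ENNReal.one_ne_top hg
  set y := (sizeGF p (ENNReal.ofReal x)).toReal with hy
  have hy1 : y ≤ 1 := ENNReal.toReal_le_of_le_ofReal zero_le_one (by simpa using hg)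
  have hy0 : 0 ≤ y := ENNReal.toReal_nonneg
  have hcs : 0 ≤ c * √(1 - x) := by positivity
  have hle : d * p d * c * √(1 - x) ≤ d * p d * (1 - y) := by
    rw [mul_assoc]; gcongr
  have hle1 : d * p d * (1 - y) ≤ 1 := by nlinarith
  refine ⟨hle.trans hle1, fun j => ?_⟩
  refine (hp.sizeGFGE_succ_le j _).trans ?_
  gcongr
  refine (mul_le_of_le_one_left zero_le hx1).trans ?_
  have hs : Summable fun i : ℕ => p i * (i * y ^ (i - 1)) :=
    hp.mean.summable.of_nonneg_of_le
      (fun i => mul_nonneg (hp.nonneg i) (by positivity)) fun i => by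
        have : (i : ℝ) * y ^ (i - 1) ≤ i := mul_le_of_le_one_right i.cast_nonneg (pow_le_one₀ hy0 hy1)
        nlinarith [hp.nonneg i]
  have e : ∑' i : ℕ, ENNReal.ofReal (p i) * (i * sizeGF p (ENNReal.ofReal x) ^ (i - 1)) =
      ENNReal.ofReal (∑' i : ℕ, p i * (i * y ^ (i - 1))) := by
    rw [ENNReal.ofReal_tsum_of_nonneg (fun i => mul_nonneg (hp.nonneg i) (by positivity)) hs]
    refine tsum_congr fun i => ?_
    rw [ENNReal.ofReal_mul (hp.nonneg i), ENNReal.ofReal_mul i.cast_nonneg, ENNReal.ofReal_natCast,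
      ENNReal.ofReal_pow hy0, hy, ENNReal.ofReal_toReal hgne]
  rw [e]
  apply ENNReal.ofReal_le_ofReal
  have h4 := le_hasSum (hp.mean.sub hs.hasSum) d fun i _ => by
    have : (i : ℝ) * y ^ (i - 1) ≤ i := mul_le_of_le_one_right i.cast_nonneg (pow_le_one₀ hy0 hy1)
    nlinarith [hp.nonneg i]
  have h5 : y ^ (d - 1) ≤ y := pow_le_of_le_one hy0 hy1 (by omega)
  have h6 : d * p d * y ^ (d - 1) ≤ d * p d * y := by gcongr
  nlinarith

lemma sizeGFGE_add_le {x c : ℝ≥0∞} (h : ∀ j, sizeGFGE p (j + 1) x ≤ c * sizeGFGE p j x) (i j : ℕ) :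
    sizeGFGE p (i + j) x ≤ c ^ i * sizeGFGE p j x := by
  induction i with
  | zero => simp
  | succ i ih =>
    rw [add_right_comm, pow_succ', mul_assoc]
    exact (h _).trans (by gcongr)

/-- Trees with few nodes are unlikely to be high. -/
lemma exists_height_size_le (hp : IsCritical p) (b : ℕ) : ∃ C : ℝ, 0 < C ∧ ∀ s t : ℕ, 1 ≤ s → 1 ≤ t →
    ∑' T : PTree, W p T * (if t ≤ T.height ∧ T.size ≤ s then 1 else 0) ≤
      ENNReal.ofReal (C / t * (√s / t) ^ b) := by
  obtain ⟨c, hc, -, H1⟩ := hp.exists_sizeGFGE_one_le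
  obtain ⟨c', hc', H2⟩ := hp.exists_sizeGFGE_succ_le
  refine ⟨3 * ((b.factorial : ℝ) * (2 * √2 / c') ^ b) * (2 / min c 1), by positivity,
    fun s t hs ht => ?_⟩
  have hs0 : (0 : ℝ) < s := by exact_mod_cast hs
  have ht0 : (0 : ℝ) < t := by exact_mod_cast ht
  set x : ℝ := s / (s + 1) with hx
  have hx0 : 0 < x := by positivity
  have hx1 : x ≤ 1 := by rw [hx, div_le_one (by positivity)]; linarith
  have hxs : ∀ N : ℕ, N ≤ s → 1 ≤ 3 * x ^ N := by
    intro N hN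
    have h1 : x ^ s ≤ x ^ N := pow_le_pow_of_le_one hx0.le hx1 hN
    have h2 : (1 / x) ^ s ≤ 3 := by
      have : 1 / x ≤ Real.exp (1 / s) := by
        have := Real.add_one_le_exp (1 / s : ℝ)
        have e : 1 / x = 1 / s + 1 := by rw [hx]; field_simp; ring
        rw [e]; exact this
      calc (1 / x) ^ s ≤ Real.exp (1 / s) ^ s := by gcongr
        _ = Real.exp 1 := by rw [← Real.exp_nat_mul]; congr 1; field_simp
        _ ≤ 3 := by have := Real.exp_one_lt_d9; linarith
    rw [div_pow, one_pow, div_le_iff₀ (by positivity)] at h2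
    linarith
  obtain ⟨h3, h4⟩ := H2 x hx0.le hx1
  have h5 : ∑' T : PTree, W p T * (if t ≤ T.height ∧ T.size ≤ s then 1 else 0) ≤
      ENNReal.ofReal 3 * sizeGFGE p t (ENNReal.ofReal x) := by
    rw [sizeGFGE, ← ENNReal.tsum_mul_left]
    refine ENNReal.tsum_le_tsum fun T => ?_
    rw [mul_left_comm]
    gcongr
    split_ifs with h5 h6 h6
    · rw [← ENNReal.ofReal_pow hx0.le, ← ENNReal.ofReal_mul (by norm_num), ← ENNReal.ofReal_one]
      exact ENNReal.ofReal_le_ofReal (hxs _ h5.2)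
    · exact absurd h5.1 h6
    · exact zero_le
    · exact zero_le
  refine h5.trans ?_
  have h6 : sizeGFGE p t (ENNReal.ofReal x) ≤
      ENNReal.ofReal (1 - c' * √(1 - x)) ^ ((t + 1) / 2) * ENNReal.ofReal (1 / (1 + c * (t / 2 : ℕ))) := by
    have := sizeGFGE_add_le h4 ((t + 1) / 2) (t / 2)
    rw [show (t + 1) / 2 + t / 2 = t by omega] at this
    refine this.trans ?_
    gcongr
    refine le_trans (ENNReal.tsum_le_tsum fun T => ?_) (H1 _)
    have : ENNReal.ofReal x ≤ 1 := by simpa using hx1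
    split_ifs
    · gcongr
    · exact le_rfl
  have h7 : 1 / (1 + c * ((t / 2 : ℕ) : ℝ)) ≤ 2 / min c 1 / t := by
    rw [div_div, div_le_div_iff₀ (by positivity) (by positivity)]
    have : (t : ℝ) ≤ 2 * ((t / 2 : ℕ) : ℝ) + 1 := by exact_mod_cast (by omega : t ≤ 2 * (t / 2) + 1)
    have m1 : min c 1 ≤ c := min_le_left _ _
    have m2 : min c 1 ≤ 1 := min_le_right _ _
    have m0 : 0 < min c 1 := by positivity
    have n0 : (0 : ℝ) ≤ ((t / 2 : ℕ) : ℝ) := by positivity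
    nlinarith
  have h8 : (1 - c' * √(1 - x)) ^ ((t + 1) / 2) ≤
      (b.factorial : ℝ) * (2 * √2 / c') ^ b * (√s / t) ^ b := by
    set i := (t + 1) / 2 with hi
    have hi2 : (t : ℝ) / 2 ≤ i := by
      rw [div_le_iff₀ two_pos]; exact_mod_cast (by omega : t ≤ i * 2)
    have e1 : 1 - x = 1 / (s + 1) := by rw [hx]; field_simp; ring
    have hlow : 1 / (√2 * √s) ≤ √(1 - x) := by
      rw [e1, Real.sqrt_div zero_le_one, Real.sqrt_one, ← Real.sqrt_mul zero_le_two]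
      have : (1 : ℝ) ≤ s := by exact_mod_cast hs
      gcongr
      linarith
    set q : ℝ := c' * √(1 - x) with hq
    have hq0 : 0 ≤ q := by positivity
    have hqt : c' * t / (2 * √2 * √s) ≤ q * i := by
      calc c' * t / (2 * √2 * √s) = c' * (1 / (√2 * √s)) * (t / 2) := by field_simp
        _ ≤ q * i := by rw [hq]; gcongr
    have ha : 0 < c' * t / (2 * √2 * √s) := by positivity
    set a := c' * t / (2 * √2 * √s) with hadef
    have hexp : a ^ b / b.factorial ≤ Real.exp a := Real.pow_div_factorial_le_exp a ha.le b
    calc (1 - q) ^ i ≤ Real.exp (-q) ^ i := by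
          apply pow_le_pow_left₀ (by linarith)
          have := Real.add_one_le_exp (-q); linarith
      _ = Real.exp (-(q * i)) := by rw [← Real.exp_nat_mul]; congr 1; ring
      _ ≤ Real.exp (-a) := by gcongr
      _ ≤ b.factorial / a ^ b := by
          rw [Real.exp_neg, ← one_div, div_le_div_iff₀ (Real.exp_pos _) (by positivity)]
          rw [div_le_iff₀ (by positivity)] at hexp
          linarith
      _ = _ := by
          rw [hadef, mul_assoc (b.factorial : ℝ), ← mul_pow, div_eq_mul_inv, ← inv_pow]
          congr 2
          field_simp
  calc ENNReal.ofReal 3 * sizeGFGE p t (ENNReal.ofReal x)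
      ≤ ENNReal.ofReal 3 * (ENNReal.ofReal (1 - c' * √(1 - x)) ^ ((t + 1) / 2) *
          ENNReal.ofReal (1 / (1 + c * (t / 2 : ℕ)))) := by gcongr
    _ = ENNReal.ofReal (3 * ((1 - c' * √(1 - x)) ^ ((t + 1) / 2) * (1 / (1 + c * (t / 2 : ℕ))))) := by
        rw [← ENNReal.ofReal_pow (by linarith), ← ENNReal.ofReal_mul (pow_nonneg (by linarith) _),
          ← ENNReal.ofReal_mul (by norm_num)]
    _ ≤ _ := by
        apply ENNReal.ofReal_le_ofReal
        calc _ ≤ 3 * (((b.factorial : ℝ) * (2 * √2 / c') ^ b * (√s / t) ^ b) * (2 / min c 1 / t)) := by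
              gcongr
          _ = _ := by ring

end IsCritical

end

section

open Filter Topology MeasureTheory
open scoped ENNReal

namespace IsCritical
variable {p : ℕ → ℝ}
open GaltonWatson

lemma pow_le_pow_add_of_le_add_cube {a b : ℝ} (hb : 0 ≤ b) (hba : b ≤ a) (h : a ≤ b + a ^ 3) (q : ℕ) :
    a ^ q ≤ b ^ q + q * a ^ (q + 2) := by
  have ha : 0 ≤ a := hb.trans hba
  induction q with
  | zero => simp
  | succ q ih =>
    have h1 : b ^ q ≤ a ^ q := by gcongr
    have h2 := mul_le_mul_of_nonneg_left ih ha
    have h3 := mul_le_mul_of_nonneg_right h (pow_nonneg hb q)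
    have h4 := mul_le_mul_of_nonneg_left h1 (pow_nonneg ha 3)
    push_cast
    calc a ^ (q + 1) ≤ a * b ^ q + q * a ^ (q + 3) := by
          rw [pow_succ' a q, pow_succ' a (q + 2)]; linarith
      _ ≤ b ^ (q + 1) + a ^ 3 * a ^ q + q * a ^ (q + 3) := by linarith [pow_succ' b q]
      _ = _ := by ring

lemma inv_sqrt_le_add_cube {s : ℕ} (hs : 1 ≤ s) :
    1 / √(s : ℝ) ≤ 1 / √((s + 1 : ℕ) : ℝ) + (1 / √(s : ℝ)) ^ 3 := by
  have hs0 : (1 : ℝ) ≤ s := by exact_mod_cast hs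
  have ha : (1 / √(s : ℝ)) ^ 2 = 1 / s := by rw [div_pow, Real.sq_sqrt (by positivity), one_pow]
  have hb : (1 / √((s + 1 : ℕ) : ℝ)) ^ 2 = 1 / (s + 1) := by
    rw [div_pow, Real.sq_sqrt (by positivity), one_pow]; push_cast; rfl
  set a := 1 / √(s : ℝ)
  set b := 1 / √((s + 1 : ℕ) : ℝ)
  have hb0 : 0 ≤ b := by positivity
  suffices a - a ^ 3 ≤ b by linarith
  refine (le_abs_self _).trans (abs_le_of_sq_le_sq ?_ hb0)
  have e : (a - a ^ 3) ^ 2 = a ^ 2 * (1 - a ^ 2) ^ 2 := by ring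
  rw [e, ha, hb]
  have e2 : 1 / (s : ℝ) * (1 - 1 / s) ^ 2 = (s - 1) ^ 2 / s ^ 3 := by field_simp
  rw [e2, div_le_div_iff₀ (by positivity) (by positivity)]
  nlinarith [sq_nonneg ((s : ℝ) - 1)]

lemma inv_sqrt_pow_le (q : ℕ) {N S : ℕ} (hN : 1 ≤ N) (hS : 1 ≤ S) :
    (1 / √(N : ℝ)) ^ q ≤ (1 / √(S : ℝ)) ^ q +
      ∑ s ∈ Finset.Ico 1 S, if N ≤ s then q * (1 / √(s : ℝ)) ^ (q + 2) else 0 := by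
  induction S, hS using Nat.le_induction with
  | base =>
    have : 1 / √(N : ℝ) ≤ 1 := by
      rw [div_le_one (Real.sqrt_pos.2 (by exact_mod_cast hN))]
      exact Real.one_le_sqrt.2 (by exact_mod_cast hN)
    simpa using pow_le_one₀ (by positivity) this
  | succ S hS ih =>
    have hanti : 1 / √((S + 1 : ℕ) : ℝ) ≤ 1 / √(S : ℝ) := by
      have : 0 < √(S : ℝ) := Real.sqrt_pos.2 (by exact_mod_cast hS)
      gcongr
      omega
    rw [Finset.sum_Ico_succ_top hS]
    by_cases h : N ≤ S
    · rw [if_pos h]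
      have := pow_le_pow_add_of_le_add_cube (by positivity) hanti (inv_sqrt_le_add_cube hS) q
      linarith
    · have h1 : (1 / √(N : ℝ)) ^ q ≤ (1 / √((S + 1 : ℕ) : ℝ)) ^ q := by
        gcongr
        omega
      have h2 : 0 ≤ ∑ s ∈ Finset.Ico 1 S, if N ≤ s then q * (1 / √(s : ℝ)) ^ (q + 2) else 0 :=
        Finset.sum_nonneg fun s _ => by split_ifs <;> positivity
      rw [if_neg h]
      linarith

/-- Integrated power of the tail mass over the high trees. -/
lemma exists_tsum_height_tailMass_le (hp : IsCritical p) (q : ℕ) : ∃ C : ℝ, 0 < C ∧ ∀ t : ℕ, 1 ≤ t →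
    ∑' T : PTree, W p T * (if t ≤ T.height then tailMass p T.size ^ q else 0) ≤
      ENNReal.ofReal (C / (t : ℝ) ^ (q + 1)) := by
  obtain ⟨C₀, hC₀, H₀⟩ := hp.exists_tailMass_le
  obtain ⟨C₁, hC₁, H₁⟩ := hp.exists_height_size_le (q + 2)
  obtain ⟨c, hc, -, H₂⟩ := hp.exists_sizeGFGE_one_le
  refine ⟨C₀ ^ q * (1 / c + q * C₁), by positivity, fun t ht => ?_⟩
  have ht0 : (0 : ℝ) < t := by exact_mod_cast ht
  have hS : 1 ≤ t ^ 2 := Nat.one_le_pow _ _ ht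
  have hsq : √((t ^ 2 : ℕ) : ℝ) = t := by rw [Nat.cast_pow, Real.sqrt_sq ht0.le]
  have hpt : ∀ T : PTree, W p T * (if t ≤ T.height then tailMass p T.size ^ q else 0) ≤
      ENNReal.ofReal (C₀ ^ q) * (ENNReal.ofReal ((1 / t) ^ q) * (W p T * (if t ≤ T.height then 1 ^ T.size else 0)) +
        ∑ s ∈ Finset.Ico 1 (t ^ 2), ENNReal.ofReal (q * (1 / √(s : ℝ)) ^ (q + 2)) *
          (W p T * (if t ≤ T.height ∧ T.size ≤ s then 1 else 0))) := by
    intro T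
    split_ifs with h
    · have hT : (0 : ℝ) < T.size := by exact_mod_cast T.size_pos
      have h1 : tailMass p T.size ^ q ≤ ENNReal.ofReal (C₀ ^ q * (1 / √(T.size : ℝ)) ^ q) := by
        rw [← mul_pow, ENNReal.ofReal_pow (by positivity), mul_one_div]
        gcongr
        exact H₀ _ hT
      have h2 := inv_sqrt_pow_le q T.size_pos hS
      rw [hsq] at h2
      have h3 : ENNReal.ofReal (C₀ ^ q * (1 / √(T.size : ℝ)) ^ q) ≤ ENNReal.ofReal (C₀ ^ q) *
          (ENNReal.ofReal ((1 / t) ^ q) + ∑ s ∈ Finset.Ico 1 (t ^ 2),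
            ENNReal.ofReal (if T.size ≤ s then q * (1 / √(s : ℝ)) ^ (q + 2) else 0)) := by
        rw [← ENNReal.ofReal_sum_of_nonneg fun s _ => by split_ifs <;> positivity,
          ← ENNReal.ofReal_add (by positivity) (Finset.sum_nonneg fun s _ => by split_ifs <;> positivity),
          ← ENNReal.ofReal_mul (by positivity)]
        apply ENNReal.ofReal_le_ofReal
        gcongr
      refine (mul_le_mul_right (h1.trans h3) (W p T)).trans (le_of_eq ?_)
      rw [mul_left_comm, mul_add, Finset.mul_sum, one_pow, mul_one, mul_comm (W p T)]
      congr 2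
      refine Finset.sum_congr rfl fun s _ => ?_
      by_cases h4 : T.size ≤ s
      · simp only [h, h4, and_self, if_true]; ring
      · simp [h4]
    · simp
  refine (ENNReal.tsum_le_tsum hpt).trans ?_
  rw [ENNReal.tsum_mul_left, ENNReal.tsum_add, ENNReal.tsum_mul_left,
    Summable.tsum_finsetSum fun _ _ => ENNReal.summable]
  simp_rw [ENNReal.tsum_mul_left]
  have hA : ∑' T : PTree, W p T * (if t ≤ T.height then 1 ^ T.size else 0) ≤ ENNReal.ofReal (1 / c / t) := by
    refine (H₂ t).trans (ENNReal.ofReal_le_ofReal ?_)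
    rw [div_div]
    gcongr
    linarith
  calc _ ≤ ENNReal.ofReal (C₀ ^ q) * (ENNReal.ofReal ((1 / t) ^ q) * ENNReal.ofReal (1 / c / t) +
        ∑ s ∈ Finset.Ico 1 (t ^ 2), ENNReal.ofReal (q * C₁ / (t : ℝ) ^ (q + 3))) := by
        gcongr with s hs
        have hs1 := (Finset.mem_Ico.1 hs).1
        have hs0 : (0 : ℝ) < s := by exact_mod_cast hs1
        refine (mul_le_mul_right (H₁ s t hs1 ht) _).trans (le_of_eq ?_)
        rw [← ENNReal.ofReal_mul (by positivity)]
        congr 1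
        have : 0 < √(s : ℝ) := Real.sqrt_pos.2 hs0
        rw [div_pow, div_pow, one_pow, pow_succ (t : ℝ) (q + 2)]
        field_simp
    _ ≤ ENNReal.ofReal (C₀ ^ q) * (ENNReal.ofReal ((1 / t) ^ q) * ENNReal.ofReal (1 / c / t) +
        ENNReal.ofReal ((t : ℝ) ^ 2 * (q * C₁ / (t : ℝ) ^ (q + 3)))) := by
        gcongr
        rw [Finset.sum_const, nsmul_eq_mul, Nat.card_Ico, ENNReal.ofReal_mul (by positivity)]
        gcongr
        rw [← Nat.cast_pow, ENNReal.ofReal_natCast]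
        gcongr
        omega
    _ = _ := by
        rw [← ENNReal.ofReal_mul (by positivity), ← ENNReal.ofReal_add (by positivity) (by positivity),
          ← ENNReal.ofReal_mul (by positivity)]
        congr 1
        rw [div_pow, one_pow]
        field_simp
        ring

end IsCritical

end

section

open Filter Topology MeasureTheory
open scoped ENNReal Classical

lemma exists_sum_equiv_of_embedding {q d : ℕ} (e : Fin q ↪ Fin d) :
    ∃ r, r ≤ d ∧ ∃ σ : Fin q ⊕ Fin r ≃ Fin d, ∀ j, σ (Sum.inl j) = e j := by
  refine ⟨Fintype.card {i // i ∉ Set.range e}, ?_, ?_⟩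
  · simpa using Fintype.card_subtype_le fun i => i ∉ Set.range e
  · refine ⟨(Equiv.sumCongr (Equiv.ofInjective e e.injective) (Fintype.equivFin _).symm).trans
      (Equiv.Set.sumCompl (Set.range e)), fun j => ?_⟩
    simp only [Equiv.trans_apply, Equiv.sumCongr_apply, Sum.map_inl]
    exact Equiv.Set.sumCompl_apply_inl _ _

namespace ENNReal

lemma tsum_fin_sum {α : Type*} {q r d : ℕ} (σ : Fin q ⊕ Fin r ≃ Fin d) (f : (Fin d → α) → ℝ≥0∞) :
    ∑' a, f a = ∑' (b : Fin q → α) (c : Fin r → α), f (Sum.elim b c ∘ σ.symm) := by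
  rw [← ((Equiv.sumArrowEquivProdArrow (Fin q) (Fin r) α).symm.trans
    (σ.arrowCongr (Equiv.refl α))).tsum_eq, ENNReal.tsum_prod']
  rfl

end ENNReal

namespace IsCritical
variable {p : ℕ → ℝ}
open GaltonWatson

/-- The weight of the configurations of `d` root subtrees in which the subtrees selected by `e`
satisfy `P` and are dominated in size by another one. -/
lemma tsum_embedding_le {C : ℝ} (hC : 0 < C) (H : ∀ r n : ℕ, 1 ≤ n →
      forestMass p r n ≤ ENNReal.ofReal (C * r / (n * √n)))
    {q d m : ℕ} (e : Fin q ↪ Fin d) (P : (Fin q → PTree) → Prop) :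
    ∑' a : Fin d → PTree, (∏ i, W p (a i)) * (if 1 + ∑ i, (a i).size = m ∧ P (a ∘ e) ∧
        ∃ i, i ∉ Set.range e ∧ ∀ j, (a (e j)).size ≤ (a i).size then 1 else 0) ≤
      ENNReal.ofReal (C * (q + 2) ^ 2 / (m * √m)) *
        (d * ∑' b : Fin q → PTree, if P b then ∏ i, W p (b i) else 0) := by
  obtain ⟨r, hr, σ, hσ⟩ := exists_sum_equiv_of_embedding e
  rw [ENNReal.tsum_fin_sum σ, ← ENNReal.tsum_mul_left, ← ENNReal.tsum_mul_left]
  refine ENNReal.tsum_le_tsum fun b => ?_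
  have hcomp : ∀ c : Fin r → PTree, (Sum.elim b c ∘ σ.symm) ∘ e = b := by
    intro c; ext j
    simp [← hσ]
  have hprod : ∀ c : Fin r → PTree, ∏ i, W p ((Sum.elim b c ∘ σ.symm) i) =
      (∏ i, W p (b i)) * ∏ i, W p (c i) := by
    intro c
    rw [← σ.prod_comp, Fintype.prod_sum_type]
    simp
  have hsum : ∀ c : Fin r → PTree, ∑ i, ((Sum.elim b c ∘ σ.symm) i).size =
      ∑ i, (b i).size + ∑ i, (c i).size := by
    intro c
    rw [← σ.sum_comp, Fintype.sum_sum_type]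
    simp
  simp_rw [hcomp, hprod, hsum]
  by_cases hP : P b
  swap
  · simp [hP]
  simp_rw [if_pos hP]
  set y := m - 1 - ∑ i, (b i).size with hy
  have hpt : ∀ c : Fin r → PTree, (∏ i, W p (b i)) * (∏ i, W p (c i)) *
      (if 1 + (∑ i, (b i).size + ∑ i, (c i).size) = m ∧ P b ∧ ∃ i, i ∉ Set.range e ∧ ∀ j,
        ((Sum.elim b c ∘ σ.symm) (e j)).size ≤ ((Sum.elim b c ∘ σ.symm) i).size then 1 else 0) ≤
      (∏ i, W p (b i)) * ((if 1 ≤ y ∧ m ≤ (q + 2) * y then 1 else 0) *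
        (if ∑ i, (c i).size = y then ∏ i, W p (c i) else 0)) := by
    intro c
    rw [mul_assoc]
    refine mul_le_mul_right ?_ _
    split_ifs with h1 h2 h3 h3
    · rw [one_mul, mul_one]
    · obtain ⟨h1, -, -⟩ := h1
      omega
    rotate_left 2
    iterate 4 simp
    all_goals
      exfalso
      obtain ⟨h1, -, i, hi, h3⟩ := h1
      obtain ⟨l, hl⟩ : ∃ l, i = σ (Sum.inr l) := by
        obtain ⟨x, rfl⟩ := σ.surjective i
        cases x with
        | inl j => exact absurd ⟨j, (hσ j).symm⟩ hi
        | inr l => exact ⟨l, rfl⟩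
      subst hl
      simp only [← hσ, Function.comp_apply, Equiv.symm_apply_apply, Sum.elim_inl,
        Sum.elim_inr] at h3
      have hc : (c l).size ≤ ∑ i, (c i).size :=
        Finset.single_le_sum (f := fun i => (c i).size) (fun _ _ => Nat.zero_le _) (Finset.mem_univ l)
      have hb : ∑ i, (b i).size ≤ q * (c l).size := by
        have := Finset.sum_le_card_nsmul Finset.univ (fun i => (b i).size) _ fun i _ => h3 i
        simpa using this
      have hy2 : y = ∑ i, (c i).size := by omega
      have hl0 := (c l).size_pos
      apply h2
      refine ⟨by omega, ?_⟩
      have : q * (c l).size ≤ q * y := by rw [hy2]; gcongr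
      have e3 : (q + 2) * y = q * y + 2 * y := by ring
      omega
  refine (ENNReal.tsum_le_tsum hpt).trans ?_
  rw [ENNReal.tsum_mul_left, ENNReal.tsum_mul_left]
  change (∏ i, W p (b i)) * ((if 1 ≤ y ∧ m ≤ (q + 2) * y then 1 else 0) * forestMass p r y) ≤ _
  rw [mul_comm (∏ i, W p (b i)), ← mul_assoc (ENNReal.ofReal _)]
  refine mul_le_mul_left ?_ _
  split_ifs with h
  swap
  · simp
  rw [one_mul]
  refine (H r y h.1).trans ?_
  rw [← ENNReal.ofReal_natCast, ← ENNReal.ofReal_mul (by positivity)]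
  apply ENNReal.ofReal_le_ofReal
  have hy0 : (1 : ℝ) ≤ y := by exact_mod_cast h.1
  have hmy : (m : ℝ) ≤ (q + 2) * y := by exact_mod_cast h.2
  have hr' : (r : ℝ) ≤ d := by exact_mod_cast hr
  rcases Nat.eq_zero_or_pos m with hm0 | hm0
  · subst hm0; omega
  have hm1 : (0 : ℝ) < m := by exact_mod_cast hm0
  have hs : √(m : ℝ) ≤ (q + 2) * √(y : ℝ) := by
    apply Real.sqrt_le_iff.2 ⟨by positivity, ?_⟩
    rw [mul_pow, Real.sq_sqrt (by positivity)]
    nlinarith [(Nat.cast_nonneg q : (0 : ℝ) ≤ q)]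
  have hms : (m : ℝ) * √m ≤ (q + 2) ^ 2 * (y * √y) := by
    calc (m : ℝ) * √m ≤ ((q + 2) * y) * ((q + 2) * √y) := by gcongr
      _ = _ := by ring
  have hys : 0 < (y : ℝ) * √y := mul_pos (by linarith) (Real.sqrt_pos.2 (by linarith))
  have hms0 : 0 < (m : ℝ) * √m := mul_pos hm1 (Real.sqrt_pos.2 hm1)
  rw [div_mul_eq_mul_div, div_le_div_iff₀ hys hms0]
  calc C * r * (m * √m) ≤ C * d * ((q + 2) ^ 2 * (y * √y)) := by gcongr
    _ = _ := by ring

/-- Estimate for an event at the root which forces `q` dominated root subtrees to satisfy `P`. -/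
lemma exists_rootEvent_le (hp : IsCritical p) (q : ℕ) : ∃ C : ℝ, 0 < C ∧
    ∀ (B : PTree → Prop) (P : ℕ → (Fin q → PTree) → Prop),
      (∀ (d : ℕ) (a : Fin d → PTree), B (PTree.ofTuple a) → ∃ e : Fin q ↪ Fin d, P d (a ∘ e) ∧
        ∃ i, i ∉ Set.range e ∧ ∀ j, (a (e j)).size ≤ (a i).size) →
      ∀ m, ∑' T, W p T * (if T.size = m ∧ B T then 1 else 0) ≤ ENNReal.ofReal C *
        (∑' d : ℕ, ENNReal.ofReal (p d) * (d ^ (q + 1) *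
          ∑' b : Fin q → PTree, if P d b then ∏ i, W p (b i) else 0)) * treeMass p m := by
  obtain ⟨C, hC, H⟩ := hp.exists_forestMass_le
  obtain ⟨c, hc, H'⟩ := hp.exists_le_treeMass_of_ne_zero
  refine ⟨C * (q + 2) ^ 2 / c, by positivity, fun B P hB m => ?_⟩
  by_cases hm : treeMass p m = 0
  · rw [hm, mul_zero, nonpos_iff_eq_zero, ENNReal.tsum_eq_zero]
    intro T
    have := ENNReal.tsum_eq_zero.1 hm T
    by_cases h : T.size = m <;> simp_all
  have h1 : ∑' T, W p T * (if T.size = m ∧ B T then 1 else 0) ≤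
      ENNReal.ofReal (C * (q + 2) ^ 2 / (m * √m)) * ∑' d : ℕ, ENNReal.ofReal (p d) * (d ^ (q + 1) *
          ∑' b : Fin q → PTree, if P d b then ∏ i, W p (b i) else 0) := by
    rw [tsum_tree hp.nonneg, ← ENNReal.tsum_mul_left]
    refine ENNReal.tsum_le_tsum fun d => ?_
    rw [mul_left_comm]
    gcongr
    calc ∑' a : Fin d → PTree, (∏ i, W p (a i)) *
          (if (PTree.ofTuple a).size = m ∧ B (PTree.ofTuple a) then 1 else 0)
        ≤ ∑' a : Fin d → PTree, ∑ e : Fin q ↪ Fin d, (∏ i, W p (a i)) *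
          (if 1 + ∑ i, (a i).size = m ∧ P d (a ∘ e) ∧
            ∃ i, i ∉ Set.range e ∧ ∀ j, (a (e j)).size ≤ (a i).size then 1 else 0) := by
          refine ENNReal.tsum_le_tsum fun a => ?_
          rw [← Finset.mul_sum]
          gcongr
          split_ifs with h
          · obtain ⟨e, he1, he2⟩ := hB d a h.2
            refine le_trans ?_ (Finset.single_le_sum (fun _ _ => zero_le) (Finset.mem_univ e))
            rw [PTree.size_ofTuple] at h
            rw [if_pos ⟨h.1, he1, he2⟩]
          · exact zero_le
      _ = ∑ e : Fin q ↪ Fin d, ∑' a : Fin d → PTree, (∏ i, W p (a i)) *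
          (if 1 + ∑ i, (a i).size = m ∧ P d (a ∘ e) ∧
            ∃ i, i ∉ Set.range e ∧ ∀ j, (a (e j)).size ≤ (a i).size then 1 else 0) :=
          Summable.tsum_finsetSum fun _ _ => ENNReal.summable
      _ ≤ ∑ e : Fin q ↪ Fin d, ENNReal.ofReal (C * (q + 2) ^ 2 / (m * √m)) *
          (d * ∑' b : Fin q → PTree, if P d b then ∏ i, W p (b i) else 0) :=
          Finset.sum_le_sum fun e _ => tsum_embedding_le hC H e _
      _ ≤ _ := by
          rw [Finset.sum_const, nsmul_eq_mul, Finset.card_univ, mul_left_comm, pow_succ (d : ℝ≥0∞),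
            mul_assoc (_ ^ q)]
          gcongr
          rw [Fintype.card_embedding_eq, Fintype.card_fin, Fintype.card_fin]
          exact_mod_cast Nat.descFactorial_le_pow d q
  have hm0 : (0 : ℝ) < m := by
    have : m ≠ 0 := by rintro rfl; exact hm treeMass_zero
    positivity
  refine h1.trans ?_
  rw [mul_right_comm]
  gcongr
  refine le_trans (le_of_eq ?_) (mul_le_mul_right (H' m hm) _)
  rw [← ENNReal.ofReal_mul (by positivity)]
  congr 1
  have := Real.sqrt_pos.2 hm0
  field_simp

end IsCritical

end

section

open Filter Topology MeasureTheory
open scoped ENNReal Classical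

namespace PTree

/-- The largest size of a root subtree. -/
def maxChild : PTree → ℕ
  | node ts => (ts.map size).foldr max 0

lemma _root_.List.foldr_max_le_iff (l : List ℕ) (b : ℕ) : l.foldr max 0 ≤ b ↔ ∀ x ∈ l, x ≤ b := by
  induction l with
  | nil => simp
  | cons t l ih => rw [List.foldr_cons, max_le_iff, ih]; simp

lemma maxChild_ofTuple_le {d : ℕ} (a : Fin d → PTree) (b : ℕ) :
    (ofTuple a).maxChild ≤ b ↔ ∀ i, (a i).size ≤ b := by
  rw [ofTuple, maxChild, List.foldr_max_le_iff]
  simp [List.mem_ofFn]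

lemma maxChild_lt_size (T : PTree) : T.maxChild < T.size := by
  obtain ⟨ts⟩ := T
  have : (ts.map size).foldr max 0 ≤ (ts.map size).sum :=
    (List.foldr_max_le_iff _ _).2 fun x hx => List.le_sum_of_mem hx
  rw [maxChild, size_node]
  omega

end PTree

namespace IsCritical
variable {p : ℕ → ℝ}
open GaltonWatson

lemma W_leaf : W p (.node []) = ENNReal.ofReal (p 0) := by
  simp [W, weight_node]

/-- Lower bound for the mass lost when passing to the largest root subtree, from trees with two
large root subtrees. -/
lemma le_tsum_drop (hp : IsCritical p) (d n h a b : ℕ) (hh : 0 < h)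
    (hb : ∀ i ∈ Finset.Ico a b, 2 * (1 + h * i) + d ≤ n) :
    ENNReal.ofReal (p (d + 2)) * ENNReal.ofReal (p 0) ^ d *
      ∑ i ∈ Finset.Ico a b, ((1 + h * i : ℕ) : ℝ≥0∞) *
        (treeMass p (1 + h * i) * treeMass p (n - (d + 2) - h * i)) ≤
      ∑' T, W p T * (if T.size = n then ((n - T.maxChild : ℕ) : ℝ≥0∞) else 0) := by
  rw [tsum_tree hp.nonneg]
  refine le_trans ?_ (ENNReal.le_tsum (d + 2))
  rw [mul_assoc]
  refine mul_le_mul_right ?_ _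
  rw [ENNReal.tsum_fin_succ]
  simp_rw [ENNReal.tsum_fin_succ]
  have h1 : ∀ x y : PTree, ENNReal.ofReal (p 0) ^ d * (W p x * W p y * ∑ i ∈ Finset.Ico a b,
      (if x.size = 1 + h * i ∧ y.size = n - (d + 2) - h * i then ((1 + h * i : ℕ) : ℝ≥0∞) else 0)) ≤
      ∑' c : Fin d → PTree, (∏ i, W p ((Fin.cons x (Fin.cons y c) : Fin (d + 2) → PTree) i)) *
        (if (PTree.ofTuple (Fin.cons x (Fin.cons y c) : Fin (d + 2) → PTree)).size = n then
          ((n - (PTree.ofTuple (Fin.cons x (Fin.cons y c) : Fin (d + 2) → PTree)).maxChild : ℕ) : ℝ≥0∞)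
          else 0) := by
    intro x y
    refine le_trans ?_ (ENNReal.le_tsum fun _ => .node [])
    rw [Fin.prod_univ_succ, Fin.prod_univ_succ]
    simp only [Fin.cons_zero, Fin.cons_succ, Finset.prod_const, W_leaf, Finset.card_univ,
      Fintype.card_fin]
    have e : ∀ w v u z : ℝ≥0∞, u * (w * v * z) = w * (v * u) * z := fun _ _ _ _ => by ring
    rw [e]
    refine mul_le_mul_right ?_ _
    by_cases hex : ∃ i ∈ Finset.Ico a b, x.size = 1 + h * i ∧ y.size = n - (d + 2) - h * i
    · obtain ⟨i, hi, hx, hy⟩ := hex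
      have hbi := hb i hi
      rw [Finset.sum_eq_single i]
      · rw [if_pos ⟨hx, hy⟩]
        have hl : (PTree.node []).size = 1 := by simp [PTree.size_node]
        rw [if_pos]
        · rw [Nat.cast_le]
          have : (PTree.ofTuple (Fin.cons x (Fin.cons y fun _ => PTree.node []) : Fin (d + 2) → PTree)).maxChild
              ≤ n - (1 + h * i) := by
            rw [PTree.maxChild_ofTuple_le, Fin.forall_fin_succ, Fin.forall_fin_succ]
            simp only [Fin.cons_zero, Fin.cons_succ, hx, hy, hl]
            exact ⟨by omega, by omega, fun _ => by omega⟩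
          omega
        · rw [PTree.size_ofTuple, Fin.sum_univ_succ, Fin.sum_univ_succ]
          simp only [Fin.cons_zero, Fin.cons_succ, hx, hy, hl, Finset.sum_const, Finset.card_univ,
            Fintype.card_fin, smul_eq_mul, mul_one]
          omega
      · intro j _ hj
        rw [if_neg]
        rintro ⟨h1, -⟩
        rw [hx] at h1
        exact hj (Nat.eq_of_mul_eq_mul_left hh (by omega)).symm
      · exact fun h => absurd hi h
    · rw [Finset.sum_eq_zero]
      · exact zero_le
      · intro i hi
        rw [if_neg]
        exact fun h => hex ⟨i, hi, h⟩
  refine le_trans (le_of_eq ?_) (ENNReal.tsum_le_tsum fun x => ENNReal.tsum_le_tsum fun y => h1 x y)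
  simp_rw [ENNReal.tsum_mul_left, Finset.mul_sum]
  have h2 : ∀ i, ((1 + h * i : ℕ) : ℝ≥0∞) *
        (treeMass p (1 + h * i) * treeMass p (n - (d + 2) - h * i)) = ∑' x, ∑' y, W p x * W p y *
      (if x.size = 1 + h * i ∧ y.size = n - (d + 2) - h * i then ((1 + h * i : ℕ) : ℝ≥0∞) else 0) := by
    intro i
    rw [treeMass, treeMass, ← ENNReal.tsum_mul_right, ← ENNReal.tsum_mul_left]
    refine tsum_congr fun x => ?_
    rw [← ENNReal.tsum_mul_left, ← ENNReal.tsum_mul_left]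
    refine tsum_congr fun y => ?_
    by_cases h3 : x.size = 1 + h * i <;> by_cases h4 : y.size = n - (d + 2) - h * i <;>
      simp [h3, h4, mul_comm]
  rw [← Finset.mul_sum]
  congr 1
  simp_rw [h2]
  rw [← Summable.tsum_finsetSum fun _ _ => ENNReal.summable]
  refine tsum_congr fun x => ?_
  rw [← Summable.tsum_finsetSum fun _ _ => ENNReal.summable]

/-- The average mass lost when passing to the largest root subtree of a tree of size `n` is at least of
order `√n`. -/
lemma exists_le_drop (hp : IsCritical p) : ∃ c : ℝ, 0 < c ∧ ∀ n : ℕ,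
    ENNReal.ofReal (c * √n) * treeMass p n ≤
      ∑' T, W p T * (if T.size = n then ((n - T.maxChild : ℕ) : ℝ≥0∞) else 0) := by
  obtain ⟨d', hd2, hpd⟩ := hp.exists_two_le_pos
  obtain ⟨d, rfl⟩ := Nat.exists_eq_add_of_le' hd2
  obtain ⟨h, hh, hdvd, hdvd', c, hc, N, H⟩ := hp.exists_le_treeMass
  obtain ⟨C, hC, HC⟩ := hp.exists_forestMass_le
  have hp0 := hp.zero_pos
  have hh0 : (1 : ℝ) ≤ h := by exact_mod_cast hh
  obtain ⟨M, hM⟩ : ∃ M : ℕ, M = 16 * h * (N + 2) + 4 * d + 8 + 2 * N := ⟨_, rfl⟩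
  have hM0 : 0 < M := by omega
  refine ⟨min (1 / √M) (p (d + 2) * p 0 ^ d * c ^ 2 / (16 * h * C)), by positivity, fun n => ?_⟩
  by_cases hn0 : treeMass p n = 0
  · simp [hn0]
  have hn1 : 0 < n := Nat.pos_of_ne_zero fun h => hn0 (h ▸ treeMass_zero)
  have hn1' : (0 : ℝ) < n := by exact_mod_cast hn1
  have hsn : 0 < √(n : ℝ) := Real.sqrt_pos.2 hn1'
  rcases lt_or_ge n M with hnM | hnM
  · have h1 : min (1 / √M) (p (d + 2) * p 0 ^ d * c ^ 2 / (16 * h * C)) * √n ≤ 1 := by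
      calc _ ≤ 1 / √M * √M := by
            gcongr
            exact min_le_left _ _
        _ = 1 := one_div_mul_cancel (Real.sqrt_pos.2 (by exact_mod_cast hM0)).ne'
    calc _ ≤ treeMass p n := mul_le_of_le_one_left zero_le (by simpa using h1)
      _ ≤ _ := by
        refine ENNReal.tsum_le_tsum fun T => ?_
        split_ifs with hT
        · refine le_mul_of_one_le_right zero_le ?_
          have := T.maxChild_lt_size
          exact_mod_cast (by omega : 1 ≤ n - T.maxChild)
        · simp
  · set b := n / (8 * h) with hb
    have hb8 : 8 * h * b ≤ n := by rw [hb]; exact Nat.mul_div_le _ _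
    have hb8' : n < 8 * h * (b + 1) := by
      rw [hb]; exact Nat.lt_mul_div_succ n (by positivity)
    have e8 : 8 * h * b = 8 * (h * b) := by ring
    refine le_trans ?_ (hp.le_tsum_drop d n h N b hh fun i hi => ?_)
    swap
    · have := (Finset.mem_Ico.1 hi).2
      have h3 : h * i ≤ h * b := Nat.mul_le_mul_left _ this.le
      omega
    have hterm : ∀ i ∈ Finset.Ico N b, ENNReal.ofReal (c ^ 2 / (n ^ 2)) ≤
        ((1 + h * i : ℕ) : ℝ≥0∞) * (treeMass p (1 + h * i) * treeMass p (n - (d + 2) - h * i)) := by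
      intro i hi
      obtain ⟨hi1, hi2⟩ := Finset.mem_Ico.1 hi
      have h3 : h * i ≤ h * b := Nat.mul_le_mul_left _ hi2.le
      have h4 : i ≤ h * i := Nat.le_mul_of_pos_left _ hh
      have g1 := H (1 + h * i) (by omega) (by simp)
      have g2 := H (n - (d + 2) - h * i) (by omega) (by
        have e : n - (d + 2) - h * i - 1 = n - 1 - ((d + 2) + h * i) := by omega
        rw [e]
        exact Nat.dvd_sub (hdvd' n hn0) (dvd_add (hdvd _ hpd.ne') (dvd_mul_right _ _)))
      set s := 1 + h * i with hs
      set r := n - (d + 2) - h * i with hr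
      have hr0 : (0 : ℝ) < r := by exact_mod_cast (by omega : 0 < r)
      have hs0 : (0 : ℝ) < s := by exact_mod_cast (by omega : 0 < s)
      have hrn : (r : ℝ) ≤ n := by exact_mod_cast (by omega : r ≤ n)
      have hsn : (s : ℝ) ≤ n := by exact_mod_cast (by omega : s ≤ n)
      refine le_trans ?_ (mul_le_mul_right (mul_le_mul' g1 g2) _)
      rw [← ENNReal.ofReal_natCast, ← ENNReal.ofReal_mul (by positivity), ← ENNReal.ofReal_mul (by positivity)]
      apply ENNReal.ofReal_le_ofReal
      have e : (s : ℝ) * (c / (s * √s) * (c / (r * √r))) = c ^ 2 / (√s * (r * √r)) := by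
        field_simp
      rw [e]
      have : √(s : ℝ) * (r * √r) ≤ n ^ 2 := by
        calc √(s : ℝ) * (r * √r) ≤ √n * (n * √n) := by gcongr
          _ = n * (√n * √n) := by ring
          _ = n ^ 2 := by rw [Real.mul_self_sqrt hn1'.le]; ring
      gcongr
    have hcard : (n : ℝ) / (16 * h) ≤ ((b - N : ℕ) : ℝ) := by
      rw [div_le_iff₀ (by positivity)]
      have : n ≤ (b - N) * (16 * h) := by
        rcases le_total b N with hbN | hbN
        · exfalso
          have : h * b ≤ h * N := Nat.mul_le_mul_left _ hbN
          have e1 : 8 * h * (b + 1) = 8 * (h * b) + 8 * h := by ring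
          have e2 : 16 * h * (N + 2) = 16 * (h * N) + 32 * h := by ring
          omega
        · obtain ⟨q, hq⟩ := Nat.exists_eq_add_of_le hbN
          rw [hq] at hb8'
          rw [hq, Nat.add_sub_cancel_left]
          have e1 : 8 * h * (N + q + 1) = 8 * (h * N) + 8 * (h * q) + 8 * h := by ring
          have e2 : 16 * h * (N + 2) = 16 * (h * N) + 32 * h := by ring
          have e3 : q * (16 * h) = 16 * (h * q) := by ring
          omega
      exact_mod_cast this
    have hup : treeMass p n ≤ ENNReal.ofReal (C / (n * √n)) := by
      have := HC 1 n hn1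
      rwa [forestMass_one, Nat.cast_one, mul_one] at this
    calc _ ≤ ENNReal.ofReal (p (d + 2) * p 0 ^ d * c ^ 2 / (16 * h * C) * √n) *
          ENNReal.ofReal (C / (n * √n)) := by
          gcongr
          exact min_le_right _ _
      _ = ENNReal.ofReal (p (d + 2)) * ENNReal.ofReal (p 0) ^ d *
          (ENNReal.ofReal (n / (16 * h)) * ENNReal.ofReal (c ^ 2 / n ^ 2)) := by
          rw [← ENNReal.ofReal_pow hp0.le, ← ENNReal.ofReal_mul (by positivity),
            ← ENNReal.ofReal_mul (by positivity), ← ENNReal.ofReal_mul (by positivity),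
            ← ENNReal.ofReal_mul (by positivity)]
          congr 1
          field_simp
      _ ≤ ENNReal.ofReal (p (d + 2)) * ENNReal.ofReal (p 0) ^ d *
          ∑ i ∈ Finset.Ico N b, ENNReal.ofReal (c ^ 2 / n ^ 2) := by
          gcongr
          rw [Finset.sum_const, Nat.card_Ico, nsmul_eq_mul]
          gcongr
          rw [← ENNReal.ofReal_natCast]
          exact ENNReal.ofReal_le_ofReal hcard
      _ ≤ _ := by
          gcongr with i hi
          exact hterm i hi

end IsCritical

end

section

open Filter Topology MeasureTheory
open scoped ENNReal Classical

namespace PTree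

lemma _root_.List.find?_attach_elim {α β : Type*} (l : List α) (q : α → Bool) (g : α → β) (b : β) :
    (match l.attach.find? (fun x => q x.1) with
      | some x => g x.1
      | none => b) = (l.find? q).elim b g := by
  conv_rhs => rw [← List.attach_map_subtype_val l, List.find?_map]
  change (match l.attach.find? (q ∘ Subtype.val) with
      | some x => g x.1
      | none => b) = _
  cases l.attach.find? (q ∘ Subtype.val) <;> rfl

/-- The index of the first maximal entry. -/
noncomputable def heavyIndex {d : ℕ} (s : Fin d → ℕ) : Option (Fin d) :=
  (List.finRange d).find? fun i => s i = (List.ofFn s).foldr max 0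

lemma heavyPath_ofTuple {d : ℕ} (a : Fin d → PTree) : (ofTuple a).heavyPath =
    ofTuple a :: (heavyIndex fun i => (a i).size).elim [] fun i => (a i).heavyPath := by
  rw [ofTuple, heavyPath]
  congr 1
  have key := List.find?_attach_elim (List.ofFn a)
    (fun x => decide (x.size = ((List.ofFn a).map size).foldr max 0)) heavyPath []
  refine Eq.trans ?_ (key.trans ?_)
  · generalize List.find? _ _ = o
    cases o <;> rfl
  rw [heavyIndex, List.map_ofFn, List.ofFn_eq_map (f := a), List.find?_map]
  change Option.elim (Option.map a (List.find? (fun i => decide ((a i).size = (List.ofFn (size ∘ a)).foldr max 0))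
    (List.finRange d))) [] heavyPath = _
  have : ∀ o : Option (Fin d), (o.map a).elim [] heavyPath = o.elim [] fun i => (a i).heavyPath := by
    intro o; cases o <;> rfl
  rw [this]
  congr!

lemma eq_maxChild_of_heavyIndex {d : ℕ} (a : Fin d → PTree) {i : Fin d}
    (h : heavyIndex (fun i => (a i).size) = some i) : (a i).size = (ofTuple a).maxChild := by
  have := List.find?_some h
  rw [ofTuple, maxChild, List.map_ofFn]
  exact of_decide_eq_true this

lemma exists_mem_heavyPath_ofTuple {d : ℕ} (a : Fin d → PTree) (B : PTree → Prop) :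
    (∃ v ∈ (ofTuple a).heavyPath, B v) ↔
      B (ofTuple a) ∨ ∃ i, heavyIndex (fun i => (a i).size) = some i ∧ ∃ v ∈ (a i).heavyPath, B v := by
  rw [heavyPath_ofTuple]
  cases heavyIndex fun i => (a i).size <;> simp

end PTree

namespace GaltonWatson
variable {p : ℕ → ℝ}
open PTree

/-- Conditionally on the sizes of the root subtrees, the heavy one is a conditioned tree. -/
lemma tsum_heavy_le {n : ℕ} (g g' : PTree → ℝ≥0∞)
    (H : ∀ m < n, ∑' T : PTree, (if T.size = m then W p T * g T else 0) ≤
      ∑' T : PTree, if T.size = m then W p T * g' T else 0) (d : ℕ) :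
    ∑' a : Fin d → PTree, (∏ i, W p (a i)) * (if (ofTuple a).size = n then
        (heavyIndex fun i => (a i).size).elim 0 (fun i => g (a i)) else 0) ≤
      ∑' a : Fin d → PTree, (∏ i, W p (a i)) * (if (ofTuple a).size = n then
        (heavyIndex fun i => (a i).size).elim 0 (fun i => g' (a i)) else 0) := by
  rw [ENNReal.tsum_fiber (fun a i => (a i).size),
    ENNReal.tsum_fiber (fun (a : Fin d → PTree) i => (a i).size)
      (f := fun a => (∏ i, W p (a i)) * (if (ofTuple a).size = n then
        (heavyIndex fun i => (a i).size).elim 0 (fun i => g' (a i)) else 0))]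
  refine ENNReal.tsum_le_tsum fun s => ?_
  by_cases hs : 1 + ∑ i, s i = n
  swap
  · refine (le_of_eq ?_).trans zero_le
    rw [ENNReal.tsum_eq_zero]
    intro a
    split_ifs with h1 h2
    · rw [size_ofTuple] at h2
      exact absurd (by rw [← h1]; exact h2) hs
    · simp
    · rfl
  rcases hi : heavyIndex s with _ | i
  · refine (le_of_eq ?_).trans zero_le
    rw [ENNReal.tsum_eq_zero]
    intro a
    split_ifs with h1 h2
    · rw [h1, hi]; simp
    · simp
    · rfl
  have key : ∀ g : PTree → ℝ≥0∞, ∑' a : Fin d → PTree, (if (fun i => (a i).size) = s then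
      (∏ i, W p (a i)) * (if (ofTuple a).size = n then
        (heavyIndex fun i => (a i).size).elim 0 (fun i => g (a i)) else 0) else 0) =
      ∏ j, ∑' T : PTree, if T.size = s j then W p T * (if j = i then g T else 1) else 0 := by
    intro g
    rw [← ENNReal.tsum_fin_prod (fun (j : Fin d) (T : PTree) =>
      if T.size = s j then W p T * (if j = i then g T else 1) else 0)]
    refine tsum_congr fun a => ?_
    by_cases h1 : (fun i => (a i).size) = s
    · have h2 : ∀ j, (a j).size = s j := fun j => congrFun h1 j
      rw [if_pos h1, h1, hi, size_ofTuple]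
      simp_rw [h2, if_true, hs]
      rw [Finset.prod_mul_distrib]
      simp
    · rw [if_neg h1]
      obtain ⟨j, hj⟩ : ∃ j, (a j).size ≠ s j := by
        by_contra! hcon
        exact h1 (funext hcon)
      exact (Finset.prod_eq_zero (Finset.mem_univ j) (if_neg hj)).symm
  rw [key g, key g']
  refine Finset.prod_le_prod' fun j _ => ?_
  by_cases hj : j = i
  · simp_rw [if_pos hj]
    refine H _ ?_
    have := Finset.single_le_sum (fun _ _ => Nat.zero_le _) (Finset.mem_univ j) (f := s)
    omega
  · simp_rw [if_neg hj]
    exact le_rfl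

end GaltonWatson

namespace IsCritical
variable {p : ℕ → ℝ}
open GaltonWatson PTree

/-- An event of conditional probability at most `ε` at the root of the trees of each size occurs along
the heavy path with probability of order at most `ε√n`. -/
lemma exists_heavyPath_le (hp : IsCritical p) : ∃ K : ℝ, 0 < K ∧ ∀ (B : PTree → Prop) (ε : ℝ≥0∞),
    (∀ m, ∑' T, W p T * (if T.size = m ∧ B T then 1 else 0) ≤ ε * treeMass p m) →
    ∀ n, ∑' T : PTree, W p T * (if T.size = n ∧ ∃ v ∈ T.heavyPath, B v then 1 else 0) ≤
      ε * ENNReal.ofReal (K * √n) * treeMass p n := by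
  obtain ⟨c, hc, Hc⟩ := hp.exists_le_drop
  refine ⟨2 / c, by positivity, fun B ε hB n => ?_⟩
  set K := 2 / c with hK
  have hK0 : 0 < K := by positivity
  induction n using Nat.strong_induction_on with | _ n ih =>
  set g : PTree → ℝ≥0∞ := fun T => if ∃ v ∈ T.heavyPath, B v then 1 else 0 with hg
  set g' : PTree → ℝ≥0∞ := fun T => ε * ENNReal.ofReal (K * √T.size) with hg'
  have hgg : ∀ m < n, ∑' T : PTree, (if T.size = m then W p T * g T else 0) ≤
      ∑' T : PTree, if T.size = m then W p T * g' T else 0 := by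
    intro m hm
    refine le_trans (le_of_eq ?_) ((ih m hm).trans (le_of_eq ?_))
    · refine tsum_congr fun T => ?_
      by_cases h : T.size = m <;> simp [h, hg]
    · rw [treeMass, ← ENNReal.tsum_mul_left]
      refine tsum_congr fun T => ?_
      by_cases h : T.size = m <;> simp [h, hg', mul_comm]
  rcases Nat.eq_zero_or_pos n with rfl | hn
  · refine (le_of_eq ?_).trans zero_le
    rw [ENNReal.tsum_eq_zero]
    intro T
    simp [T.size_pos.ne']
  have hn0 : (0 : ℝ) < n := by exact_mod_cast hn
  have hsn : 0 < √(n : ℝ) := Real.sqrt_pos.2 hn0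
  have h1 : ∑' T : PTree, W p T * (if T.size = n ∧ ∃ v ∈ T.heavyPath, B v then 1 else 0) ≤
      ∑' T, W p T * (if T.size = n ∧ B T then 1 else 0) +
      ∑' d, ENNReal.ofReal (p d) * ∑' a : Fin d → PTree, (∏ i, W p (a i)) *
        (if (ofTuple a).size = n then
          (heavyIndex fun i => (a i).size).elim 0 (fun i => g (a i)) else 0) := by
    rw [tsum_tree hp.nonneg, tsum_tree hp.nonneg, ← ENNReal.tsum_add]
    refine ENNReal.tsum_le_tsum fun d => ?_
    rw [← mul_add, ← ENNReal.tsum_add]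
    refine mul_le_mul_right (ENNReal.tsum_le_tsum fun a => ?_) _
    rw [← mul_add]
    refine mul_le_mul_right ?_ _
    by_cases h2 : (ofTuple a).size = n
    swap
    · simp [h2]
    simp only [h2, true_and, if_true]
    by_cases h4 : ∃ v ∈ (ofTuple a).heavyPath, B v
    swap
    · rw [if_neg h4]; exact zero_le
    rw [if_pos h4]
    rcases (exists_mem_heavyPath_ofTuple a B).1 h4 with h3 | ⟨i, hi, hv⟩
    · rw [if_pos h3]; exact le_self_add
    · rw [hi, Option.elim_some, hg]
      simp only [if_pos hv]
      exact le_add_self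
  have h2 : ∑' d, ENNReal.ofReal (p d) * ∑' a : Fin d → PTree, (∏ i, W p (a i)) *
        (if (ofTuple a).size = n then
          (heavyIndex fun i => (a i).size).elim 0 (fun i => g (a i)) else 0) ≤
      ∑' T, W p T * (if T.size = n then ε * ENNReal.ofReal (K * √T.maxChild) else 0) := by
    rw [tsum_tree hp.nonneg]
    refine ENNReal.tsum_le_tsum fun d => ?_
    refine mul_le_mul_right ((tsum_heavy_le g g' hgg d).trans (ENNReal.tsum_le_tsum fun a => ?_)) _
    refine mul_le_mul_right ?_ _
    split_ifs
    · rcases hi : heavyIndex fun i => (a i).size with _ | i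
      · exact zero_le
      · rw [Option.elim_some, hg', ← eq_maxChild_of_heavyIndex a hi]
    · exact le_rfl
  have h3 : treeMass p n ≤ ∑' T, W p T * (if T.size = n then
      ENNReal.ofReal (K / (2 * √n) * (n - T.maxChild : ℕ)) else 0) := by
    have := mul_le_mul_right (Hc n) (ENNReal.ofReal (K / (2 * √n)))
    rw [← mul_assoc, ← ENNReal.ofReal_mul (by positivity), ← ENNReal.tsum_mul_left] at this
    have e : K / (2 * √n) * (c * √n) = 1 := by rw [hK]; field_simp
    rw [e, ENNReal.ofReal_one, one_mul] at this
    refine this.trans (le_of_eq (tsum_congr fun T => ?_))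
    split_ifs
    · rw [mul_left_comm, ENNReal.ofReal_mul (by positivity), ENNReal.ofReal_natCast]
    · simp
  calc _ ≤ ε * treeMass p n +
        ∑' T, W p T * (if T.size = n then ε * ENNReal.ofReal (K * √T.maxChild) else 0) :=
        h1.trans (add_le_add (hB n) h2)
    _ = ε * (treeMass p n + ∑' T, W p T * (if T.size = n then ENNReal.ofReal (K * √T.maxChild) else 0)) := by
        rw [mul_add, ← ENNReal.tsum_mul_left]
        congr 1
        refine tsum_congr fun T => ?_
        split_ifs
        · ring
        · simp
    _ ≤ ε * (ENNReal.ofReal (K * √n) * treeMass p n) := by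
        refine mul_le_mul_right ((add_le_add_left h3 _).trans ?_) _
        rw [← ENNReal.tsum_add, treeMass, ← ENNReal.tsum_mul_left]
        refine ENNReal.tsum_le_tsum fun T => ?_
        by_cases hT : T.size = n
        swap
        · simp [hT]
        simp only [hT, if_true]
        rw [← mul_add, mul_comm (ENNReal.ofReal (K * √n))]
        refine mul_le_mul_right ?_ _
        rw [← ENNReal.ofReal_add (by positivity) (by positivity)]
        apply ENNReal.ofReal_le_ofReal
        have hlt : T.maxChild ≤ n := by have := T.maxChild_lt_size; omega
        rw [Nat.cast_sub hlt]
        have hu : √(T.maxChild : ℝ) ≤ √n := Real.sqrt_le_sqrt (by exact_mod_cast hlt)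
        have e1 : (T.maxChild : ℝ) = √(T.maxChild : ℝ) * √(T.maxChild : ℝ) :=
          (Real.mul_self_sqrt (by positivity)).symm
        have e2 : (n : ℝ) = √n * √n := (Real.mul_self_sqrt (by positivity)).symm
        have hu0 : 0 ≤ √(T.maxChild : ℝ) := Real.sqrt_nonneg _
        have h5 : K / (2 * √n) * (n - T.maxChild) ≤ K * (√n - √T.maxChild) := by
          rw [div_mul_eq_mul_div, div_le_iff₀ (by positivity)]
          have : (n : ℝ) - T.maxChild ≤ (√n - √T.maxChild) * (2 * √n) := by
            nlinarith [mul_nonneg (sub_nonneg.2 hu) (sub_nonneg.2 hu)]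
          nlinarith
        linarith
    _ = _ := by ring

end IsCritical

end

section

open Filter Topology MeasureTheory
open scoped ENNReal Classical

/-- A set of more than `q` indices contains `q` of them whose values are dominated by that of
another one. -/
lemma Finset.exists_embedding_le {d q : ℕ} (s : Fin d → ℕ) (S : Finset (Fin d)) (hS : q + 1 ≤ S.card) :
    ∃ e : Fin q ↪ Fin d, (∀ j, e j ∈ S) ∧ ∃ i ∈ S, i ∉ Set.range e ∧ ∀ j, s (e j) ≤ s i := by
  obtain ⟨i, hi, him⟩ := S.exists_max_image s (Finset.card_pos.1 (by omega))
  obtain ⟨R, hR, hRc⟩ := Finset.exists_subset_card_eq (s := S.erase i) (n := q)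
    (by rw [Finset.card_erase_of_mem hi]; omega)
  have hmem (j : Fin q) : R.orderEmbOfFin hRc j ∈ S.erase i := hR (R.orderEmbOfFin_mem hRc j)
  refine ⟨(R.orderEmbOfFin hRc).toEmbedding, fun j => Finset.mem_of_mem_erase (hmem j), i, hi, ?_,
    fun j => him _ (Finset.mem_of_mem_erase (hmem j))⟩
  rintro ⟨j, hj⟩
  exact Finset.ne_of_mem_erase (hmem j) hj

lemma Finset.card_filter_eq_countP_finRange {d : ℕ} (P : Fin d → Prop) [DecidablePred P] :
    (Finset.univ.filter P).card = (List.finRange d).countP fun i => decide (P i) := by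
  rw [List.countP_eq_length_filter, Fin.univ_def]
  rfl

namespace PTree

lemma perm_sortedSizesDesc {d : ℕ} (a : Fin d → PTree) :
    (ofTuple a).sortedSizesDesc.Perm (List.ofFn fun i => (a i).size) := by
  refine (List.perm_insertionSort _ _).trans ?_
  rw [ofTuple, childSizes, List.map_ofFn]
  rfl

lemma pairwise_sortedSizesDesc (T : PTree) : T.sortedSizesDesc.Pairwise (· ≥ ·) :=
  List.pairwise_insertionSort _ _

lemma card_le_size_of_le_Nk {d : ℕ} (a : Fin d → PTree) {q : ℕ} {x : ℝ} (hx : 0 < x)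
    (h : x ≤ ((ofTuple a).Nk (q + 1) : ℝ)) :
    q + 1 ≤ (Finset.univ.filter fun i => x ≤ ((a i).size : ℝ)).card := by
  set L := (ofTuple a).sortedSizesDesc with hL
  have hq : q < L.length := by
    by_contra! hlt
    rw [Nk, Nat.add_sub_cancel, List.getD_eq_default _ _ hlt] at h
    push_cast at h
    linarith
  have h0 : x ≤ (L[q] : ℝ) := by
    rwa [Nk, Nat.add_sub_cancel, List.getD_eq_getElem _ _ hq] at h
  have h1 : ∀ y ∈ L.take (q + 1), x ≤ (y : ℝ) := by
    intro y hy
    obtain ⟨j, hj, rfl⟩ := List.getElem_of_mem hy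
    rw [List.length_take] at hj
    rw [List.getElem_take]
    refine h0.trans (Nat.cast_le.2 ?_)
    rcases Nat.lt_or_ge j q with hjq | hjq
    · exact List.pairwise_iff_getElem.1 (pairwise_sortedSizesDesc (ofTuple a)) j q _ hq hjq
    · obtain rfl : j = q := by omega
      exact le_rfl
  have h2 : q + 1 ≤ L.countP fun y : ℕ => decide (x ≤ (y : ℝ)) := by
    calc q + 1 = (L.take (q + 1)).countP fun y : ℕ => decide (x ≤ (y : ℝ)) := by
          rw [List.countP_eq_length.2 (by simpa using h1), List.length_take]; omega
      _ ≤ _ := (List.take_sublist _ _).countP_le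
  rw [(perm_sortedSizesDesc a).countP_eq, List.ofFn_eq_map, List.countP_map] at h2
  refine h2.trans (le_of_eq ?_)
  rw [Finset.card_filter_eq_countP_finRange]
  rfl

lemma NkPlus_le {d : ℕ} (a : Fin d → PTree) (q : ℕ) :
    (ofTuple a).NkPlus (q + 1) ≤ d * (ofTuple a).Nk (q + 1) := by
  have hlen : (ofTuple a).sortedSizesDesc.length = d := by
    rw [(perm_sortedSizesDesc a).length_eq, List.length_ofFn]
  rw [NkPlus, Nk, Nat.add_sub_cancel]
  refine (List.sum_le_card_nsmul _ ((ofTuple a).sortedSizesDesc.getD q 0) ?_).trans ?_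
  · intro y hy
    obtain ⟨j, hj, rfl⟩ := List.getElem_of_mem hy
    rw [List.length_drop] at hj
    rw [List.getElem_drop, List.getD_eq_getElem _ _ (by omega)]
    rcases Nat.eq_zero_or_pos j with rfl | hj0
    · simp
    · exact List.pairwise_iff_getElem.1 (pairwise_sortedSizesDesc (ofTuple a)) q (q + j) _ _ (by omega)
  · rw [smul_eq_mul, List.length_drop, hlen]
    exact Nat.mul_le_mul_right _ (Nat.sub_le _ _)

lemma exists_height_eq_Hstar {d : ℕ} (a : Fin d → PTree) {ℓ : ℕ} (h : 0 < Hstar (ofTuple a) ℓ) :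
    ∃ i : Fin d, (a i).height = Hstar (ofTuple a) ℓ ∧
      ℓ ≤ (Finset.univ.filter fun j => j ≠ i ∧ (a i).size ≤ (a j).size).card + 1 := by
  rw [ofTuple, Hstar] at h
  rw [ofTuple, Hstar]
  generalize hf : List.find? _ _ = o at h
  rcases o with _ | i
  · exact absurd h (lt_irrefl _)
  have hmem := List.mem_of_find?_eq_some hf
  have hr := List.find?_some hf
  simp only [List.length_ofFn, List.mem_range] at hmem
  replace hr := of_decide_eq_true hr
  refine ⟨⟨i, hmem⟩, ?_, ?_⟩
  · change _ = ((List.ofFn a).getD i (node [])).height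
    simp [hmem]
  · rw [← hr, rankIn, add_comm]
    have hget (j : Fin d) : ((List.ofFn a).map size).getD j 0 = (a j).size := by
      simp
    have hlen : ((List.ofFn a).map size).length = d := by simp
    gcongr
    rw [hlen, ← List.countP_eq_length_filter, ← List.map_coe_finRange_eq_range, List.countP_map,
      Finset.card_filter_eq_countP_finRange]
    refine List.countP_mono_left fun j _ hj => ?_
    have hi := hget ⟨i, hmem⟩
    simp only [Function.comp_apply, decide_eq_true_eq, hget, hi] at hj ⊢
    rcases hj with hj | ⟨hj, hji⟩
    · exact ⟨fun h => by rw [h] at hj; exact lt_irrefl _ hj, hj.le⟩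
    · exact ⟨fun h => by rw [h] at hji; exact lt_irrefl _ hji, hj.ge⟩

end PTree

end

section

open Filter Topology MeasureTheory
open scoped ENNReal Classical

namespace GaltonWatson
variable {p : ℕ → ℝ}

lemma tsum_subtype_weight (hp : ∀ i, 0 ≤ p i) (A : PTree → Prop) :
    ∑' T : {T : PTree // A T}, weight p T.1 = (∑' T, W p T * (if A T then 1 else 0)).toReal := by
  have h : ∑' T, W p T * (if A T then 1 else 0) = ∑' T : {T : PTree // A T}, W p T.1 := by
    rw [show (∑' T : {T : PTree // A T}, W p T.1) = ∑' T : {T : PTree | A T}, W p T.1 from rfl,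
      tsum_subtype {T : PTree | A T} (W p)]
    refine tsum_congr fun T => ?_
    by_cases hT : A T <;> simp [hT]
  rw [h, ENNReal.tsum_toReal_eq (f := fun T : {T : PTree // A T} => W p T.1) fun T => ENNReal.ofReal_ne_top]
  exact tsum_congr fun T => (ENNReal.toReal_ofReal (weight_nonneg hp T.1)).symm

lemma treeSum_eq_toReal (hp : ∀ i, 0 ≤ p i) (n : ℕ) : treeSum p n = (treeMass p n).toReal := by
  rw [treeSum, tsum_subtype_weight hp fun T => T.size = n, treeMass]
  simp

lemma tsum_moment_ne_top (hp : ∀ i, 0 ≤ p i) {m s : ℝ} (h : MomentFinite p m) (hs : 0 < s) (hsm : s ≤ m) :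
    ∑' d : ℕ, ENNReal.ofReal (p d) * ENNReal.ofReal ((d : ℝ) ^ s) ≠ ⊤ := by
  simp_rw [← ENNReal.ofReal_mul (hp _)]
  refine Summable.tsum_ofReal_ne_top (Summable.of_nonneg_of_le (fun d => ?_) (fun d => ?_) h)
  · exact mul_nonneg (hp d) (by positivity)
  · rw [mul_comm]
    refine mul_le_mul_of_nonneg_right ?_ (hp d)
    rcases Nat.eq_zero_or_pos d with rfl | hd
    · rw [Nat.cast_zero, Real.zero_rpow hs.ne', Real.zero_rpow (hs.trans_le hsm).ne']
    · exact Real.rpow_le_rpow_of_exponent_le (by exact_mod_cast hd) hsm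

end GaltonWatson

namespace IsCritical
variable {p : ℕ → ℝ}
open GaltonWatson PTree

lemma condProb_le (hp : IsCritical p) {n : ℕ} (hn : n ∈ gwSupport p) {A : PTree → Prop} {c : ℝ} (hc : 0 ≤ c)
    (h : ∑' T, W p T * (if T.size = n ∧ A T then 1 else 0) ≤ ENNReal.ofReal c * treeMass p n) :
    condProb p n A ≤ c := by
  rw [condProb, div_le_iff₀ hn.2, tsum_subtype_weight hp.nonneg fun T => T.size = n ∧ A T,
    treeSum_eq_toReal hp.nonneg]
  have := ENNReal.toReal_mono (ENNReal.mul_ne_top ENNReal.ofReal_ne_top (hp.treeMass_ne_top n)) h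
  rw [ENNReal.toReal_mul, ENNReal.toReal_ofReal hc] at this
  refine le_trans (le_of_eq ?_) this
  congr!

lemma exists_condProb_heavyPath_le (hp : IsCritical p) {B : ℝ → PTree → Prop} {f : ℝ → ℝ}
    (hf : ∀ t, 1 ≤ t → 0 ≤ f t)
    (H : ∃ C : ℝ, 0 < C ∧ ∀ t, 1 ≤ t → ∀ m, ∑' T, W p T * (if T.size = m ∧ B t T then 1 else 0) ≤
      ENNReal.ofReal (C * f t) * treeMass p m) :
    ∃ C : ℝ, 0 < C ∧ ∀ n ∈ gwSupport p, ∀ t, 1 ≤ t →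
      condProb p n (fun T => ∃ v ∈ T.heavyPath, B t v) ≤ C * √n * f t := by
  obtain ⟨C, hC, H⟩ := H
  obtain ⟨K, hK, H'⟩ := hp.exists_heavyPath_le
  refine ⟨C * K, by positivity, fun n hn t ht => hp.condProb_le hn ?_ ?_⟩
  · have := hf t ht
    positivity
  · refine le_trans (le_of_eq ?_) ((H' (B t) _ (H t ht) n).trans (le_of_eq ?_))
    · congr!
    · rw [← ENNReal.ofReal_mul (mul_nonneg hC.le (hf t ht))]
      congr 2
      ring

/-- Root events forcing more than `q` subtrees of the root to be large. -/
lemma exists_rootEvent_Nk_le (hp : IsCritical p) (q : ℕ) : ∃ C : ℝ, 0 < C ∧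
    ∀ (B : PTree → Prop) (θ : ℕ → ℝ),
      (∀ (d : ℕ) (a : Fin d → PTree), B (ofTuple a) → 0 < θ d ∧ θ d ≤ ((ofTuple a).Nk (q + 1) : ℝ)) →
      ∀ m, ∑' T, W p T * (if T.size = m ∧ B T then 1 else 0) ≤
        ENNReal.ofReal C * (∑' d : ℕ, ENNReal.ofReal (p d) * (d ^ (q + 1) * tailMass p (θ d) ^ q)) *
          treeMass p m := by
  obtain ⟨C, hC, H⟩ := hp.exists_rootEvent_le q
  refine ⟨C, hC, fun B θ hB m => ?_⟩
  refine (H B (fun d b => ∀ j, θ d ≤ ((b j).size : ℝ)) (fun d a ha => ?_) m).trans (le_of_eq ?_)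
  · obtain ⟨h0, h1⟩ := hB d a ha
    obtain ⟨e, he, i, hi, hi', hdom⟩ := Finset.exists_embedding_le (fun i => (a i).size) _
      (card_le_size_of_le_Nk a h0 h1)
    exact ⟨e, fun j => by simpa using he j, i, hi', hdom⟩
  · congr 2
    refine tsum_congr fun d => ?_
    congr 2
    rw [tailMass, ← Fin.prod_const,
      ← ENNReal.tsum_fin_prod (fun _ (T : PTree) => if θ d ≤ (T.size : ℝ) then W p T else 0)]
    refine tsum_congr fun b => ?_
    split_ifs with h
    · exact Finset.prod_congr rfl fun i _ => (if_pos (h i)).symm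
    · push Not at h
      obtain ⟨i, hi⟩ := h
      exact (Finset.prod_eq_zero (Finset.mem_univ i) (if_neg hi.not_ge)).symm

lemma exists_root_Nk_le (hp : IsCritical p) (q : ℕ) (hq : MomentFinite p (q + 2)) :
    ∃ C : ℝ, 0 < C ∧ ∀ t : ℝ, 1 ≤ t → ∀ m,
      ∑' T : PTree, W p T * (if T.size = m ∧ t ≤ (T.Nk (q + 1) : ℝ) then 1 else 0) ≤
        ENNReal.ofReal (C * t ^ (-(q : ℝ) / 2)) * treeMass p m := by
  obtain ⟨C, hC, H⟩ := hp.exists_rootEvent_Nk_le q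
  obtain ⟨C', hC', H'⟩ := hp.exists_tailMass_le
  have hM := tsum_moment_ne_top hp.nonneg hq (s := q + 1) (by positivity) (by linarith)
  set M := (∑' d : ℕ, ENNReal.ofReal (p d) * ENNReal.ofReal ((d : ℝ) ^ ((q : ℝ) + 1))) with hMdef
  refine ⟨C * (M.toReal + 1) * C' ^ q, by positivity, fun t ht m => ?_⟩
  have ht0 : 0 < t := by linarith
  refine (H (fun T => t ≤ (T.Nk (q + 1) : ℝ)) (fun _ => t) (fun d a h => ⟨ht0, h⟩) m).trans ?_
  refine mul_le_mul_left ?_ _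
  have hM1 : M ≤ ENNReal.ofReal (M.toReal + 1) := by
    rw [ENNReal.le_ofReal_iff_toReal_le hM (by positivity)]; linarith
  have hpow : tailMass p t ^ q ≤ ENNReal.ofReal (C' ^ q * t ^ (-(q : ℝ) / 2)) := by
    refine (pow_le_pow_left' (H' t ht0) q).trans (le_of_eq ?_)
    rw [← ENNReal.ofReal_pow (by positivity), div_pow, div_eq_mul_inv, Real.sqrt_eq_rpow,
      ← Real.rpow_mul_natCast ht0.le, ← Real.rpow_neg ht0.le]
    congr 3
    ring
  calc _ ≤ ENNReal.ofReal C * (M * ENNReal.ofReal (C' ^ q * t ^ (-(q : ℝ) / 2))) := by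
        refine mul_le_mul_right ?_ _
        rw [← ENNReal.tsum_mul_right]
        refine ENNReal.tsum_le_tsum fun d => ?_
        rw [mul_assoc]
        refine mul_le_mul_right ?_ _
        have e : ENNReal.ofReal ((d : ℝ) ^ ((q : ℝ) + 1)) = (d : ℝ≥0∞) ^ (q + 1) := by
          rw [← Nat.cast_add_one, Real.rpow_natCast, ENNReal.ofReal_pow (by positivity), ENNReal.ofReal_natCast]
        rw [e]
        exact mul_le_mul_right hpow _
    _ ≤ ENNReal.ofReal C * (ENNReal.ofReal (M.toReal + 1) * ENNReal.ofReal (C' ^ q * t ^ (-(q : ℝ) / 2))) :=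
        mul_le_mul_right (mul_le_mul_left hM1 _) _
    _ = _ := by
        rw [← ENNReal.ofReal_mul (by positivity), ← ENNReal.ofReal_mul (by positivity)]
        congr 1
        ring

lemma exists_root_NkPlus_le (hp : IsCritical p) (q : ℕ) (hq : MomentFinite p ((3 * ((q : ℝ) + 1) + 1) / 2)) :
    ∃ C : ℝ, 0 < C ∧ ∀ t : ℝ, 1 ≤ t → ∀ m,
      ∑' T : PTree, W p T * (if T.size = m ∧ t ≤ (T.NkPlus (q + 1) : ℝ) then 1 else 0) ≤
        ENNReal.ofReal (C * t ^ (-(q : ℝ) / 2)) * treeMass p m := by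
  obtain ⟨C, hC, H⟩ := hp.exists_rootEvent_Nk_le q
  obtain ⟨C', hC', H'⟩ := hp.exists_tailMass_le
  have hM := tsum_moment_ne_top hp.nonneg hq (s := q + 1 + q / 2) (by positivity) (by linarith)
  set M := (∑' d : ℕ, ENNReal.ofReal (p d) * ENNReal.ofReal ((d : ℝ) ^ ((q : ℝ) + 1 + q / 2))) with hMdef
  refine ⟨C * (M.toReal + 1) * C' ^ q, by positivity, fun t ht m => ?_⟩
  have ht0 : 0 < t := by linarith
  refine (H (fun T => t ≤ (T.NkPlus (q + 1) : ℝ)) (fun d => t / d) (fun d a h => ?_) m).trans ?_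
  · have h1 : t ≤ d * ((ofTuple a).Nk (q + 1) : ℝ) := h.trans (by exact_mod_cast NkPlus_le a q)
    have hd : (0 : ℝ) < d := by
      rcases Nat.eq_zero_or_pos d with rfl | hd
      · simp only [Nat.cast_zero, zero_mul] at h1
        linarith
      · exact_mod_cast hd
    exact ⟨by positivity, by rwa [div_le_iff₀ hd, mul_comm]⟩
  refine mul_le_mul_left ?_ _
  have hM1 : M ≤ ENNReal.ofReal (M.toReal + 1) := by
    rw [ENNReal.le_ofReal_iff_toReal_le hM (by positivity)]; linarith
  calc _ ≤ ENNReal.ofReal C * (M * ENNReal.ofReal (C' ^ q * t ^ (-(q : ℝ) / 2))) := by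
        refine mul_le_mul_right ?_ _
        rw [← ENNReal.tsum_mul_right]
        refine ENNReal.tsum_le_tsum fun d => ?_
        rw [mul_assoc]
        refine mul_le_mul_right ?_ _
        rcases Nat.eq_zero_or_pos d with rfl | hd
        · simp
        have hd0 : (0 : ℝ) < d := by exact_mod_cast hd
        have e : (d : ℝ≥0∞) ^ (q + 1) = ENNReal.ofReal ((d : ℝ) ^ ((q : ℝ) + 1)) := by
          rw [← Nat.cast_add_one, Real.rpow_natCast, ENNReal.ofReal_pow (by positivity), ENNReal.ofReal_natCast]
        refine (mul_le_mul_right (pow_le_pow_left' (H' (t / d) (by positivity)) q) _).trans (le_of_eq ?_)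
        rw [e, ← ENNReal.ofReal_pow (by positivity), ← ENNReal.ofReal_mul (by positivity),
          ← ENNReal.ofReal_mul (by positivity), div_pow, div_eq_mul_inv, Real.sqrt_eq_rpow,
          ← Real.rpow_mul_natCast (by positivity), ← Real.rpow_neg (by positivity),
          Real.div_rpow ht0.le hd0.le, Real.rpow_add hd0 (_ + 1), div_eq_mul_inv, ← Real.rpow_neg hd0.le,
          show (-(-(1 / 2 * (q : ℝ)))) = q / 2 by ring, show (-(1 / 2 * (q : ℝ))) = -(q : ℝ) / 2 by ring]
        congr 1
        ring
    _ ≤ ENNReal.ofReal C * (ENNReal.ofReal (M.toReal + 1) * ENNReal.ofReal (C' ^ q * t ^ (-(q : ℝ) / 2))) :=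
        mul_le_mul_right (mul_le_mul_left hM1 _) _
    _ = _ := by
        rw [← ENNReal.ofReal_mul (by positivity), ← ENNReal.ofReal_mul (by positivity)]
        congr 1
        ring

end IsCritical

end

section

open Filter Topology MeasureTheory
open scoped ENNReal Classical

namespace IsCritical
variable {p : ℕ → ℝ}
open GaltonWatson PTree

lemma exists_root_Hstar_le (hp : IsCritical p) (q : ℕ) (hq : MomentFinite p (((q : ℝ) + 2) + 2)) :
    ∃ C : ℝ, 0 < C ∧ ∀ t : ℝ, 1 ≤ t → ∀ m,
      ∑' T : PTree, W p T * (if T.size = m ∧ ∃ ℓ, q + 2 ≤ ℓ ∧ t ≤ (Hstar T ℓ : ℝ) then 1 else 0) ≤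
        ENNReal.ofReal (C * t ^ (-((q : ℝ) + 1))) * treeMass p m := by
  obtain ⟨C, hC, H⟩ := hp.exists_rootEvent_le (q + 1)
  obtain ⟨C', hC', H'⟩ := hp.exists_tsum_height_tailMass_le q
  have hM := tsum_moment_ne_top hp.nonneg hq (s := q + 2) (by positivity) (by linarith)
  set M := (∑' d : ℕ, ENNReal.ofReal (p d) * ENNReal.ofReal ((d : ℝ) ^ ((q : ℝ) + 2))) with hMdef
  refine ⟨C * (M.toReal + 1) * C', by positivity, fun t ht m => ?_⟩
  have ht0 : 0 < t := by linarith
  have hM1 : M ≤ ENNReal.ofReal (M.toReal + 1) := by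
    rw [ENNReal.le_ofReal_iff_toReal_le hM (by positivity)]; linarith
  have hceil : 1 ≤ ⌈t⌉₊ := Nat.one_le_ceil_iff.2 ht0
  have key : (∑' b : Fin (q + 1) → PTree,
      if ⌈t⌉₊ ≤ (b 0).height ∧ ∀ j : Fin q, (b 0).size ≤ (b j.succ).size then ∏ i, W p (b i) else 0) ≤
      ENNReal.ofReal (C' * t ^ (-((q : ℝ) + 1))) := by
    rw [ENNReal.tsum_fin_succ]
    refine le_trans (le_of_eq (tsum_congr fun T => ?_)) ((H' _ hceil).trans ?_)
    · by_cases hT : ⌈t⌉₊ ≤ T.height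
      swap
      · simp [hT]
      simp only [Fin.cons_zero, Fin.cons_succ, hT, true_and, if_true]
      rw [tailMass, ← Fin.prod_const,
        ← ENNReal.tsum_fin_prod (fun _ (T' : PTree) => if (T.size : ℝ) ≤ (T'.size : ℝ) then W p T' else 0),
        ← ENNReal.tsum_mul_left]
      refine tsum_congr fun b => ?_
      split_ifs with h
      · rw [Fin.prod_univ_succ]
        simp only [Fin.cons_zero, Fin.cons_succ]
        congr 1
        exact Finset.prod_congr rfl fun i _ => (if_pos (Nat.cast_le.2 (h i))).symm
      · push Not at h
        obtain ⟨i, hi⟩ := h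
        rw [Finset.prod_eq_zero (Finset.mem_univ i) (if_neg (Nat.cast_lt.2 hi).not_ge), mul_zero]
    · apply ENNReal.ofReal_le_ofReal
      rw [div_eq_mul_inv, Real.rpow_neg ht0.le, ← Nat.cast_add_one, Real.rpow_natCast]
      have := Nat.le_ceil t
      gcongr
  refine (H (fun T => ∃ ℓ, q + 2 ≤ ℓ ∧ t ≤ (Hstar T ℓ : ℝ)) (fun _ b => ⌈t⌉₊ ≤ (b 0).height ∧
    ∀ j : Fin q, (b 0).size ≤ (b j.succ).size) (fun d a ha => ?_) m).trans ?_
  · obtain ⟨ℓ, hℓ, hle⟩ := ha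
    have hpos : 0 < Hstar (ofTuple a) ℓ := by exact_mod_cast ht0.trans_le hle
    obtain ⟨i, hi, hcard⟩ := exists_height_eq_Hstar a hpos
    obtain ⟨e, he, i', hi', hr, hdom⟩ := Finset.exists_embedding_le (q := q) (fun i => (a i).size) _
      (by omega : q + 1 ≤ (Finset.univ.filter fun j => j ≠ i ∧ (a i).size ≤ (a j).size).card)
    simp only [Finset.mem_filter, Finset.mem_univ, true_and] at he hi'
    have hne : i ∉ Set.range e := by
      rintro ⟨j, hj⟩
      exact (he j).1 hj
    refine ⟨⟨Fin.cons i e, Fin.cons_injective_iff.2 ⟨hne, e.injective⟩⟩, ⟨?_, fun j => ?_⟩, i', ?_, fun j => ?_⟩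
    · rw [Nat.ceil_le]
      simp only [Function.Embedding.coeFn_mk, Function.comp_apply, Fin.cons_zero, hi]
      exact hle
    · simpa using (he j).2
    · simp only [Function.Embedding.coeFn_mk]
      rintro ⟨j, hj⟩
      refine Fin.cases (fun h => ?_) (fun j h => ?_) j hj
      · exact hi'.1 h.symm
      · exact hr ⟨j, h⟩
    · refine Fin.cases ?_ (fun j => ?_) j
      · simpa using hi'.2
      · simpa using hdom j
  refine mul_le_mul_left ?_ _
  calc _ ≤ ENNReal.ofReal C * (M * ENNReal.ofReal (C' * t ^ (-((q : ℝ) + 1)))) := by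
        refine mul_le_mul_right ?_ _
        rw [← ENNReal.tsum_mul_right]
        refine ENNReal.tsum_le_tsum fun d => ?_
        rw [mul_assoc]
        refine mul_le_mul_right ?_ _
        have e : ENNReal.ofReal ((d : ℝ) ^ ((q : ℝ) + 2)) = (d : ℝ≥0∞) ^ (q + 1 + 1) := by
          rw [show (q : ℝ) + 2 = ((q + 1 + 1 : ℕ) : ℝ) by push_cast; ring, Real.rpow_natCast,
            ENNReal.ofReal_pow (by positivity), ENNReal.ofReal_natCast]
        rw [e]
        refine mul_le_mul_right (le_trans (le_of_eq ?_) key) _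
        congr!
    _ ≤ ENNReal.ofReal C * (ENNReal.ofReal (M.toReal + 1) * ENNReal.ofReal (C' * t ^ (-((q : ℝ) + 1)))) :=
        mul_le_mul_right (mul_le_mul_left hM1 _) _
    _ = _ := by
        rw [← ENNReal.ofReal_mul (by positivity), ← ENNReal.ofReal_mul (by positivity)]
        congr 1
        ring

end IsCritical

lemma le_foldr_max_iff {α : Type*} (l : List α) (f : α → ℕ) {t : ℝ} (ht : 0 < t) :
    t ≤ (((l.map f).foldr max 0 : ℕ) : ℝ) ↔ ∃ v ∈ l, t ≤ (f v : ℝ) := by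
  induction l with
  | nil => simp [ht]
  | cons x l ih =>
    rw [List.map_cons, List.foldr_cons, Nat.cast_max, le_max_iff, ih]
    simp

end

/-- tail bounds along the heavy path: for `N_k`, `N_{k+}` and for the
heights of the subtrees hanging off the heavy path at ranks `≥ k`. -/
theorem stmt_14 (p : ℕ → ℝ)
    (hp_nonneg : ∀ i, 0 ≤ p i)
    (hp_sum : ∑' i : ℕ, p i = 1)
    (hp_mean : ∑' i : ℕ, (i : ℝ) * p i = 1)
    (hp_sq : Summable (fun i : ℕ => (i : ℝ) ^ 2 * p i))
    (hp_var : 1 < ∑' i : ℕ, (i : ℝ) ^ 2 * p i)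
    (k : ℕ) (hk : 2 ≤ k) :
    (MomentFinite p ((k : ℝ) + 1) →
      ∃ C₁ : ℝ, 0 < C₁ ∧ ∀ n ∈ gwSupport p, ∀ t : ℝ, 1 ≤ t →
        condProb p n
            (fun T => t ≤ (((T.heavyPath.map (PTree.Nk k)).foldr max 0 : ℕ) : ℝ)) ≤
          C₁ * Real.sqrt n * t ^ (-((k : ℝ) - 1) / 2))
    ∧ (MomentFinite p ((3 * (k : ℝ) + 1) / 2) →
        ∃ C₁ : ℝ, 0 < C₁ ∧ ∀ n ∈ gwSupport p, ∀ t : ℝ, 1 ≤ t →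
          condProb p n
              (fun T => t ≤ (((T.heavyPath.map (PTree.NkPlus k)).foldr max 0 : ℕ) : ℝ)) ≤
            C₁ * Real.sqrt n * t ^ (-((k : ℝ) - 1) / 2))
    ∧ (MomentFinite p ((k : ℝ) + 2) →
        ∃ C₂ : ℝ, 0 < C₂ ∧ ∀ n ∈ gwSupport p, ∀ t : ℝ, 1 ≤ t →
          condProb p n
              (fun T => ∃ v ∈ T.heavyPath, ∃ ℓ : ℕ, k ≤ ℓ ∧ t ≤ (Hstar v ℓ : ℝ)) ≤
            C₂ * Real.sqrt n * t ^ (-((k : ℝ) - 1))) := by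
  have hs : Summable p := by
    by_contra h
    rw [tsum_eq_zero_of_not_summable h] at hp_sum
    exact zero_ne_one hp_sum
  have hm : Summable fun i : ℕ => (i : ℝ) * p i := by
    by_contra h
    rw [tsum_eq_zero_of_not_summable h] at hp_mean
    exact zero_ne_one hp_mean
  have hp : IsCritical p := ⟨hp_nonneg, hp_sum ▸ hs.hasSum, hp_mean ▸ hm.hasSum, hp_sq, hp_var⟩
  obtain ⟨q, rfl⟩ : ∃ q, k = q + 2 := ⟨k - 2, by omega⟩
  have h0 (x : ℝ) (t : ℝ) (ht : 1 ≤ t) : 0 ≤ t ^ x := Real.rpow_nonneg (by linarith) x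
  refine ⟨fun h => ?_, fun h => ?_, fun h => ?_⟩
  · obtain ⟨C, hC, H⟩ := hp.exists_condProb_heavyPath_le (h0 _)
      (hp.exists_root_Nk_le (q + 1) (by convert h using 1; push_cast; ring))
    refine ⟨C, hC, fun n hn t ht => ?_⟩
    simp only [le_foldr_max_iff _ _ (zero_lt_one.trans_le ht)]
    convert H n hn t ht using 4
    push_cast
    ring
  · obtain ⟨C, hC, H⟩ := hp.exists_condProb_heavyPath_le (h0 _)
      (hp.exists_root_NkPlus_le (q + 1) (by convert h using 1; push_cast; ring))
    refine ⟨C, hC, fun n hn t ht => ?_⟩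
    simp only [le_foldr_max_iff _ _ (zero_lt_one.trans_le ht)]
    convert H n hn t ht using 4
    push_cast
    ring
  · obtain ⟨C, hC, H⟩ := hp.exists_condProb_heavyPath_le (h0 _)
      (hp.exists_root_Hstar_le q (by convert h using 1; push_cast; ring))
    refine ⟨C, hC, fun n hn t ht => ?_⟩
    convert H n hn t ht using 3
    push_cast
    ring
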